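/- arXiv:2008.09936 — 4 statements merged into one kernel-verified Lean document; each statement's English description precedes it below -/
import Mathlib

section
/- Let f ∈ 𝒟(α,β) and g ∈ 𝒟(a,b) with g ≥ f and g(k) - f(k) ≥ (a-α)k - (b-β) for all k. Then the convex hull (g-f)^c belongs to 𝒟(a-α, b-β). -/
open MeasureTheory Set Filter

noncomputable def pot (eta : Measure ℝ) (k : ℝ) : ℝ := ∫ x, max (k - x) 0 ∂eta

noncomputable def cpot (eta : Measure ℝ) (k : ℝ) : ℝ := ∫ x, max (x - k) 0 ∂eta

/-- `c` is the convex hull (largest convex minorant) of `f`. -/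
def IsConvexHull (f c : ℝ → ℝ) : Prop :=
  ConvexOn ℝ Set.univ c ∧ (∀ x, c x ≤ f x) ∧
    ∀ g : ℝ → ℝ, ConvexOn ℝ Set.univ g → (∀ x, g x ≤ f x) → ∀ x, g x ≤ c x

/-- Convex order: `∫ f dη ≤ ∫ f dχ` for all convex `f` for which both integrals exist. -/
def Cx (eta chi : Measure ℝ) : Prop :=
  ∀ f : ℝ → ℝ, ConvexOn ℝ Set.univ f → Integrable f eta → Integrable f chi →
    ∫ x, f x ∂eta ≤ ∫ x, f x ∂chi

/-- Extended convex order: `∫ f dη ≤ ∫ f dχ` for all nonnegative convex `f`. -/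
def ECx (eta chi : Measure ℝ) : Prop :=
  ∀ f : ℝ → ℝ, ConvexOn ℝ Set.univ f → (∀ x, 0 ≤ f x) →
    ∫⁻ x, ENNReal.ofReal (f x) ∂eta ≤ ∫⁻ x, ENNReal.ofReal (f x) ∂chi

/-- The class `𝒟(a, b)`: nonnegative, nondecreasing, convex functions vanishing at `-∞`
and asymptotic to `a * z - b` at `+∞`. -/
def MemD (a b : ℝ) (f : ℝ → ℝ) : Prop :=
  ConvexOn ℝ Set.univ f ∧ Monotone f ∧ (∀ x, 0 ≤ f x) ∧
    Tendsto f atBot (nhds 0) ∧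
    Tendsto (fun z => f z - (a * z - b)) atTop (nhds 0)

/-- `S` is the shadow of `μ` in `ν`. -/
def IsShadow (mu nu S : Measure ℝ) : Prop :=
  Cx mu S ∧ S ≤ nu ∧ ∀ eta : Measure ℝ, Cx mu eta → eta ≤ nu → Cx S eta

/-- `T` is the counter-shadow of `μ` in `ν`. -/
def IsCounterShadow (mu nu T : Measure ℝ) : Prop :=
  Cx mu T ∧ T ≤ nu ∧ ∀ eta : Measure ℝ, Cx mu eta → eta ≤ nu → Cx eta T

theorem stmt4 (f g c : ℝ → ℝ) (α β a b : ℝ)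
    (hα : 0 ≤ α) (ha : 0 ≤ a)
    (hf : MemD α β f) (hg : MemD a b g)
    (hge : ∀ x, f x ≤ g x)
    (hlin : ∀ k, (a - α) * k - (b - β) ≤ g k - f k)
    (hc : IsConvexHull (fun k => g k - f k) c) :
    MemD (a - α) (b - β) c := by 
  obtain ⟨hfc, hfm, hf0, hfb, hft⟩ := hf
  obtain ⟨hgc, hgm, hg0, hgb, hgt⟩ := hg
  obtain ⟨hcc, hcle, hmax⟩ := hc
  have h0 : ∀ x, 0 ≤ c x :=
    hmax (fun _ => 0) (convexOn_const 0 convex_univ) (fun x => sub_nonneg.2 (hge x))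
  have hl : ∀ x, (a - α) * x - (b - β) ≤ c x := by
    refine hmax (fun x => (a - α) * x - (b - β)) ⟨convex_univ, ?_⟩ hlin
    intro x _ y _ s t _ _ hst
    have : t = 1 - s := by linarith
    subst this
    simp only [smul_eq_mul]
    apply le_of_eq
    ring
  have hcb : Tendsto c atBot (nhds 0) := by
    refine tendsto_of_tendsto_of_tendsto_of_le_of_le tendsto_const_nhds hgb h0 ?_
    intro x
    have h1 := hcle x
    have h2 := hf0 x
    simp only at h1
    linarith
  refine ⟨hcc, ?_, h0, hcb, ?_⟩
  · intro x y hxy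
    by_contra hlt
    rw [not_le] at hlt
    have hne : x < y := lt_of_le_of_ne hxy (by rintro rfl; exact lt_irrefl _ hlt)
    have hz : ∀ z, z < x → c x ≤ c z := by
      intro z hzx
      have h := hcc.slope_mono_adjacent (mem_univ z) (mem_univ y) hzx hne
      have h3 : (c y - c x) / (y - x) < 0 :=
        div_neg_of_neg_of_pos (by linarith) (by linarith)
      have h4 : (c x - c z) / (x - z) < 0 := lt_of_le_of_lt h h3
      by_contra h5
      rw [not_le] at h5
      have : 0 < (c x - c z) / (x - z) := div_pos (by linarith) (by linarith)
      linarith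
    have h6 : c x ≤ 0 := by
      refine ge_of_tendsto hcb ?_
      filter_upwards [eventually_lt_atBot x] with z hzx using hz z hzx
    have := h0 y
    linarith
  · have ht : Tendsto (fun z => (g z - (a * z - b)) - (f z - (α * z - β))) atTop (nhds 0) := by
      simpa using hgt.sub hft
    refine tendsto_of_tendsto_of_tendsto_of_le_of_le tendsto_const_nhds ht ?_ ?_
    · intro z
      have := hl z
      simp only
      linarith
    · intro z
      have := hcle z
      simp only at this ⊢
      linarith
end

section
/- For finite measures μ, ν on ℝ with finite first moments, the following are equivalent: (i) μ ≤_E ν; (ii) there exists a finite measure η with μ ≤_cx η and η ≤ ν (setwise); (iii) there exists a finite measure χ with μ ≤ χ (setwise) and χ ≤_cx ν. -/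
open MeasureTheory Set Filter

theorem sandwich {E : Type*} [AddCommGroup E] [Module ℝ E] (p q : E → ℝ) (C : Set E)
    (p_hom : ∀ c : ℝ, 0 < c → ∀ x, p (c • x) = c * p x)
    (p_add : ∀ x y, p (x + y) ≤ p x + p y)
    (C0 : (0 : E) ∈ C) (C_add : ∀ x ∈ C, ∀ y ∈ C, x + y ∈ C)
    (C_smul : ∀ c : ℝ, 0 < c → ∀ x ∈ C, c • x ∈ C)
    (q0 : q 0 = 0)
    (q_add : ∀ x ∈ C, ∀ y ∈ C, q (x + y) = q x + q y)
    (q_smul : ∀ c : ℝ, 0 < c → ∀ x ∈ C, q (c • x) = c * q x)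
    (hle : ∀ x ∈ C, q x ≤ p x) :
    ∃ L : E →ₗ[ℝ] ℝ, (∀ x, L x ≤ p x) ∧ ∀ x ∈ C, q x ≤ L x := by
  have p0 : p 0 = 0 := by
    have := p_hom 2 (by norm_num) 0
    rw [smul_zero] at this; linarith
  let N : E → ℝ := fun g => ⨅ c : C, (p (g + c) - q c)
  have : Nonempty C := ⟨⟨0, C0⟩⟩
  have bdd : ∀ g, BddBelow (Set.range fun c : C => (p (g + c) - q c)) := by
    intro g
    refine ⟨- p (-g), ?_⟩
    rintro _ ⟨c, rfl⟩
    have h1 := p_add (g + c) (-g)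
    have h2 := hle c c.2
    rw [add_neg_cancel_comm] at h1
    simp only
    linarith
  have N_le : ∀ g c, c ∈ C → N g ≤ p (g + c) - q c := fun g c hc => ciInf_le (bdd g) ⟨c, hc⟩
  have N_half : ∀ a : ℝ, 0 < a → ∀ x, N (a • x) ≤ a * N x := by
    intro a ha x
    rw [← div_le_iff₀' ha]
    refine le_ciInf fun c => ?_
    rw [div_le_iff₀' ha]
    have := N_le (a • x) (a • (c : E)) (C_smul a ha c c.2)
    rw [← smul_add, p_hom a ha, q_smul a ha c c.2] at this
    linarith
  have N_hom : ∀ a : ℝ, 0 < a → ∀ x, N (a • x) = a * N x := by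
    intro a ha x
    refine le_antisymm (N_half a ha x) ?_
    have := N_half a⁻¹ (inv_pos.2 ha) (a • x)
    rw [smul_smul, inv_mul_cancel₀ ha.ne', one_smul] at this
    calc a * N x ≤ a * (a⁻¹ * N (a • x)) := by gcongr
      _ = N (a • x) := by field_simp
  have N_add : ∀ x y, N (x + y) ≤ N x + N y := by
    intro x y
    refine le_ciInf_add_ciInf fun c d => ?_
    have h1 := N_le (x + y) (c + d) (C_add c c.2 d d.2)
    have h2 := p_add (x + c) (y + d)
    rw [q_add c c.2 d d.2] at h1
    rw [show x + (c : E) + (y + d) = x + y + (c + d) by abel] at h2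
    linarith
  have N0 : N 0 = 0 := by
    have := N_hom 2 (by norm_num) 0
    rw [smul_zero] at this; linarith
  obtain ⟨L, -, hL⟩ := exists_extension_of_le_sublinear (⊥ : E →ₗ.[ℝ] ℝ) N N_hom N_add (by
    rintro ⟨x, hx⟩
    have hx' : x = 0 := (Submodule.mem_bot ℝ).1 hx
    subst hx'
    have : (⊥ : E →ₗ.[ℝ] ℝ) ⟨0, hx⟩ = 0 := LinearPMap.map_zero _
    rw [this]; exact N0.ge)
  refine ⟨L, fun x => ?_, fun x hx => ?_⟩
  · have := N_le x 0 C0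
    rw [add_zero, q0, sub_zero] at this
    exact (hL x).trans this
  · have h1 := N_le (-x) x hx
    have h2 := hL (-x)
    rw [neg_add_cancel, p0] at h1
    rw [map_neg] at h2
    linarith

theorem int_pos_part {nu : Measure ℝ} {f : ℝ → ℝ} (hf : Integrable f nu) :
    Integrable (fun x => max (f x) 0) nu := hf.pos_part

theorem cx_cont {f : ℝ → ℝ} (hf : ConvexOn ℝ univ f) : Continuous f :=
  continuousOn_univ.1 (hf.continuousOn isOpen_univ)

theorem exists_functional (mu nu : Measure ℝ) [IsFiniteMeasure mu] [IsFiniteMeasure nu]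
    (h : ECx mu nu) :
    ∃ L : (ℝ → ℝ) →ₗ[ℝ] ℝ, (∀ f, Integrable f nu → L f ≤ ∫ x, max (f x) 0 ∂nu) ∧
      ∀ f, ConvexOn ℝ univ f → Integrable f mu → Integrable f nu → ∫ x, f x ∂mu ≤ L f := by
  let V : Submodule ℝ (ℝ → ℝ) :=
    { carrier := {f | Integrable f nu}
      add_mem' := fun ha hb => Integrable.add ha hb
      zero_mem' := integrable_zero _ _ _
      smul_mem' := fun c _ hf => Integrable.smul c hf }
  obtain ⟨L, hL1, hL2⟩ := sandwich (E := V) (fun f => ∫ x, max (f.1 x) 0 ∂nu)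
    (fun f => ∫ x, f.1 x ∂mu) {f | ConvexOn ℝ univ f.1 ∧ Integrable f.1 mu}
    (by
      intro c hc f
      rw [← integral_const_mul]
      congr 1; ext x
      rw [mul_max_of_nonneg _ _ hc.le, mul_zero]; rfl)
    (by
      intro f g
      rw [← integral_add (int_pos_part f.2) (int_pos_part g.2)]
      refine integral_mono (int_pos_part (f + g).2)
        ((int_pos_part f.2).add (int_pos_part g.2)) fun x => ?_
      have h1 := le_max_left (f.1 x) 0
      have h2 := le_max_left (g.1 x) 0
      have h3 := le_max_right (f.1 x) 0
      have h4 := le_max_right (g.1 x) 0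
      refine max_le ?_ ?_
      · change f.1 x + g.1 x ≤ max (f.1 x) 0 + max (g.1 x) 0
        linarith
      · change 0 ≤ max (f.1 x) 0 + max (g.1 x) 0
        linarith)
    ⟨convexOn_const 0 convex_univ, integrable_zero _ _ _⟩
    (fun f hf g hg => ⟨hf.1.add hg.1, hf.2.add hg.2⟩)
    (fun c hc f hf => ⟨hf.1.smul hc.le, hf.2.smul c⟩)
    (by simp)
    (fun f hf g hg => integral_add hf.2 hg.2)
    (fun c hc f hf => integral_const_mul c _)
    (by
      rintro f ⟨hf, hfm⟩
      have h1 : ∫ x, f.1 x ∂mu ≤ ∫ x, max (f.1 x) 0 ∂mu :=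
        integral_mono hfm (int_pos_part hfm) fun x => le_max_left _ _
      refine h1.trans ?_
      have h2 := h (fun x => max (f.1 x) 0) (hf.sup (convexOn_const 0 convex_univ))
        (fun x => le_max_right _ _)
      rw [← ofReal_integral_eq_lintegral_ofReal (int_pos_part hfm)
        (ae_of_all _ fun x => le_max_right _ _),
        ← ofReal_integral_eq_lintegral_ofReal (int_pos_part f.2)
        (ae_of_all _ fun x => le_max_right _ _)] at h2
      exact (ENNReal.ofReal_le_ofReal_iff (integral_nonneg fun x => le_max_right _ _)).1 h2)
  obtain ⟨L', hL'⟩ := LinearMap.exists_extend L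
  have key : ∀ f : V, L' f.1 = L f := fun f => by rw [← hL']; rfl
  refine ⟨L', fun f hf => ?_, fun f hf hm hn => ?_⟩
  · rw [key ⟨f, hf⟩]; exact hL1 ⟨f, hf⟩
  · rw [key ⟨f, hn⟩]; exact hL2 ⟨f, hn⟩ ⟨hf, hm⟩

theorem exists_repr (nu : Measure ℝ) [IsFiniteMeasure nu] (L : (ℝ → ℝ) →ₗ[ℝ] ℝ)
    (hL : ∀ f, Integrable f nu → L f ≤ ∫ x, max (f x) 0 ∂nu) :
    ∃ eta : Measure ℝ, eta ≤ nu ∧ ∀ f, Integrable f nu → L f = ∫ x, f x ∂eta := by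
  have hnn : ∀ f, Integrable f nu → (∀ x, 0 ≤ f x) → 0 ≤ L f := by
    intro f hf h0
    have := hL (-f) hf.neg
    have h2 : ∀ x, max ((-f) x) 0 = 0 := fun x => max_eq_right (by simpa using h0 x)
    simp only [h2, integral_zero, map_neg] at this
    linarith
  have hup : ∀ f, Integrable f nu → (∀ x, 0 ≤ f x) → L f ≤ ∫ x, f x ∂nu := by
    intro f hf h0
    have := hL f hf
    simpa only [max_eq_left (h0 _)] using this
  have habs : ∀ f, Integrable f nu → |L f| ≤ ∫ x, |f x| ∂nu := by
    intro f hf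
    rw [abs_le]
    constructor
    · have := hL (-f) hf.neg
      rw [map_neg] at this
      have h2 : ∫ x, max ((-f) x) 0 ∂nu ≤ ∫ x, |f x| ∂nu :=
        integral_mono (int_pos_part hf.neg) hf.abs
          fun x => max_le (neg_le_abs _) (abs_nonneg _)
      linarith
    · exact (hL f hf).trans (integral_mono (int_pos_part hf) hf.abs
          fun x => max_le (le_abs_self _) (abs_nonneg _))
  have hI : ∀ s : Set ℝ, MeasurableSet s → Integrable (s.indicator (1 : ℝ → ℝ)) nu :=
    fun s hs => (integrable_const (1 : ℝ)).indicator hs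
  have hI0 : ∀ s : Set ℝ, ∀ x, 0 ≤ s.indicator (1 : ℝ → ℝ) x :=
    fun s x => indicator_nonneg (fun _ _ => zero_le_one) x
  have hU : ∀ ⦃f : ℕ → Set ℝ⦄ (_ : ∀ i, MeasurableSet (f i)), Pairwise (Function.onFun Disjoint f) →
      ENNReal.ofReal (L ((⋃ i, f i).indicator 1)) =
        ∑' i, ENNReal.ofReal (L ((f i).indicator 1)) := by
    intro A hA hd
    have hs : HasSum (fun i => L ((A i).indicator 1)) (L ((⋃ i, A i).indicator 1)) := by
      rw [hasSum_iff_tendsto_nat_of_nonneg (fun i => hnn _ (hI _ (hA i)) (hI0 _))]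
      have hν : Tendsto (fun n => ∑ i ∈ Finset.range n, nu.real (A i)) atTop
          (nhds (nu.real (⋃ i, A i))) := by
        have := hasSum_integral_iUnion (μ := nu) (f := fun _ => (1 : ℝ)) hA hd
          (integrable_const _).integrableOn
        simpa using this.tendsto_sum_nat
      have h0 : Tendsto (fun n => nu.real (⋃ i, A i) - ∑ i ∈ Finset.range n, nu.real (A i)) atTop
          (nhds 0) := by
        simpa using hν.const_sub (nu.real (⋃ i, A i))
      have h1 : ∀ n, |L ((⋃ i, A i).indicator 1) -
          ∑ i ∈ Finset.range n, L ((A i).indicator 1)| ≤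
          nu.real (⋃ i, A i) - ∑ i ∈ Finset.range n, nu.real (A i) := by
        intro n
        have hint : Integrable ((⋃ i, A i).indicator (1 : ℝ → ℝ) -
            ∑ i ∈ Finset.range n, (A i).indicator (1 : ℝ → ℝ)) nu :=
          (hI _ (MeasurableSet.iUnion hA)).sub (integrable_finsetSum' _ fun i _ => hI _ (hA i))
        have hpos : ∀ x, 0 ≤ ((⋃ i, A i).indicator (1 : ℝ → ℝ) -
            ∑ i ∈ Finset.range n, (A i).indicator (1 : ℝ → ℝ)) x := by
          intro x
          rw [Pi.sub_apply, Finset.sum_apply, sub_nonneg,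
            ← Finset.indicator_biUnion_apply _ _ (fun i _ j _ hij => hd hij)]
          exact indicator_le_indicator_of_subset (iUnion₂_subset fun i _ => subset_iUnion A i)
            (fun _ => zero_le_one) x
        rw [← map_sum, ← map_sub, abs_of_nonneg (hnn _ hint hpos)]
        refine (hup _ hint hpos).trans_eq ?_
        simp only [Pi.sub_apply, Finset.sum_apply]
        rw [integral_sub (hI _ (MeasurableSet.iUnion hA))
          (integrable_finsetSum _ fun i _ => hI _ (hA i)),
          integral_finsetSum _ (fun i _ => hI _ (hA i)),
          integral_indicator_one (MeasurableSet.iUnion hA)]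
        simp only [integral_indicator_one (hA _)]
      have h2 : Tendsto (fun n => L ((⋃ i, A i).indicator 1) -
          ∑ i ∈ Finset.range n, L ((A i).indicator 1)) atTop (nhds 0) :=
        squeeze_zero_norm h1 h0
      simpa using h2.const_sub (L ((⋃ i, A i).indicator 1))
    rw [← hs.tsum_eq, ENNReal.ofReal_tsum_of_nonneg (fun i => hnn _ (hI _ (hA i)) (hI0 _))
      hs.summable]
  let eta : Measure ℝ := Measure.ofMeasurable (fun s _ => ENNReal.ofReal (L (s.indicator 1)))
    (by rw [Set.indicator_empty, show (fun _ : ℝ => (0 : ℝ)) = 0 from rfl, map_zero, ENNReal.ofReal_zero]) hU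
  have heta : ∀ s, MeasurableSet s → eta s = ENNReal.ofReal (L (s.indicator 1)) :=
    fun s hs => Measure.ofMeasurable_apply s hs
  have hle : eta ≤ nu := by
    refine Measure.le_intro fun s hs _ => ?_
    rw [heta s hs]
    refine ENNReal.ofReal_le_of_le_toReal ?_
    refine (hup _ (hI s hs) (hI0 s)).trans_eq ?_
    rw [integral_indicator_one hs]; rfl
  have : IsFiniteMeasure eta := isFiniteMeasure_of_le nu hle
  refine ⟨eta, hle, fun f hf => ?_⟩
  refine Integrable.induction (μ := nu) (fun f => L f = ∫ x, f x ∂eta) ?_ ?_ ?_ ?_ hf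
  · intro c s hs _
    have : s.indicator (fun _ : ℝ => c) = c • s.indicator (1 : ℝ → ℝ) := by
      ext x; by_cases hx : x ∈ s <;> simp [hx]
    rw [integral_indicator_const c hs, this, map_smul, Measure.real, heta s hs,
      ENNReal.toReal_ofReal (hnn _ (hI s hs) (hI0 s)), smul_eq_mul, smul_eq_mul, mul_comm]
  · intro f g _ hf hg h1 h2
    rw [map_add, h1, h2]
    exact (integral_add (hf.mono_measure hle) (hg.mono_measure hle)).symm
  · refine isClosed_eq ?_ ?_
    · refine (LipschitzWith.of_dist_le_mul (K := 1) fun f g => ?_).continuous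
      rw [Real.dist_eq, ← map_sub, NNReal.coe_one, one_mul, L1.dist_eq_integral_dist]
      exact habs _ ((L1.integrable_coeFn f).sub (L1.integrable_coeFn g))
    · refine (LipschitzWith.of_dist_le_mul (K := 1) fun f g => ?_).continuous
      have hf := L1.integrable_coeFn f
      have hg := L1.integrable_coeFn g
      rw [Real.dist_eq, ← integral_sub (hf.mono_measure hle) (hg.mono_measure hle),
        NNReal.coe_one, one_mul, L1.dist_eq_integral_dist]
      refine (abs_integral_le_integral_abs).trans ?_
      exact integral_mono_measure hle (ae_of_all _ fun x => abs_nonneg _) (hf.sub hg).abs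
  · intro f g hfg hf h1
    have hg := hf.congr hfg
    have h2 := habs _ (hf.sub hg)
    have h3 : ∫ x, |(f - g) x| ∂nu = 0 := by
      rw [← integral_zero ℝ ℝ (μ := nu)]
      refine integral_congr_ae (hfg.mono fun x hx => ?_)
      simp [hx]
    rw [h3, map_sub] at h2
    have h4 : L f - L g = 0 := abs_nonpos_iff.1 h2
    have h5 : ∫ x, f x ∂eta = ∫ x, g x ∂eta :=
      integral_congr_ae (hle.absolutelyContinuous.ae_le hfg)
    show L g = ∫ x, g x ∂eta
    linarith

/-- Approximation of convex functions by convex functions of linear growth. -/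
theorem cx_approx {f : ℝ → ℝ} (hf : ConvexOn ℝ univ f) :
    ∃ F : ℕ → ℝ → ℝ, (∀ n, ConvexOn ℝ univ (F n)) ∧
      (∀ eta : Measure ℝ, IsFiniteMeasure eta → Integrable (fun x => x) eta →
        ∀ n, Integrable (F n) eta) ∧
      (∀ x, Monotone fun n => F n x) ∧ (∀ n x, F n x ≤ f x) ∧
      ∀ x, Tendsto (fun n => F n x) atTop (nhds (f x)) := by
  obtain ⟨l, c, hle, hsup⟩ := hf.real_univ_sSup_of_nat_affine_eq (cx_cont hf).lowerSemicontinuous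
  let a : ℕ → ℝ → ℝ := fun i => l i + Function.const ℝ (c i)
  have hF : ∀ n x, partialSups a n x = partialSups (fun i => a i x) n := by
    intro n x
    induction n with
    | zero => simp
    | succ n ih =>
      rw [← Order.succ_eq_add_one, partialSups_succ, partialSups_succ, Pi.sup_apply, ih]
  have hacx : ∀ i, ConvexOn ℝ univ (a i) := fun i =>
    ((l i).toLinearMap.convexOn convex_univ).add (convexOn_const _ convex_univ)
  have hsup' : ∀ x, ⨆ i, a i x = f x := fun x => by
    rw [← hsup, iSup_apply]
  have hbd : ∀ x, BddAbove (range fun i => a i x) := fun x =>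
    ⟨f x, by rintro _ ⟨i, rfl⟩; exact hle i x⟩
  have hmono : ∀ x, Monotone fun n => partialSups a n x :=
    fun x m n hmn => (partialSups a).monotone hmn x
  have hlef : ∀ n x, partialSups a n x ≤ f x := fun n x =>
    partialSups_le a n f (fun i _ => hle i) x
  refine ⟨fun n => partialSups a n, ?_, ?_, hmono, hlef, ?_⟩
  · intro n
    induction n with
    | zero => simpa using hacx 0
    | succ n ih =>
      change ConvexOn ℝ univ (partialSups a (Order.succ n))
      rw [partialSups_succ]
      exact ih.sup (hacx _)
  · intro eta _ hx n
    have hai : ∀ i, Integrable (a i) eta := fun i =>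
      ((l i).integrable_comp hx).add (integrable_const _)
    induction n with
    | zero => simpa using hai 0
    | succ n ih =>
      change Integrable (partialSups a (Order.succ n)) eta
      rw [partialSups_succ]
      exact ih.sup (hai _)
  · intro x
    have h1 := tendsto_atTop_ciSup (hmono x) ⟨f x, by rintro _ ⟨n, rfl⟩; exact hlef n x⟩
    have h2 : ⨆ n, partialSups a n x = f x := by
      simp only [hF]
      rw [ciSup_partialSups_eq (hbd x), hsup']
    rwa [h2] at h1

/-- To check the convex order it suffices to consider functions integrable for
all measures with finite first moment. -/
theorem cx_of_good (al be : Measure ℝ) [IsFiniteMeasure al] [IsFiniteMeasure be]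
    (ha : Integrable (fun x => x) al) (hb : Integrable (fun x => x) be)
    (h : ∀ f : ℝ → ℝ, ConvexOn ℝ univ f → (∀ eta : Measure ℝ, IsFiniteMeasure eta →
      Integrable (fun x => x) eta → Integrable f eta) → ∫ x, f x ∂al ≤ ∫ x, f x ∂be) :
    Cx al be := by
  intro f hf hfa hfb
  obtain ⟨F, hFc, hFi, hFm, hFle, hFt⟩ := cx_approx hf
  have h1 := integral_tendsto_of_tendsto_of_monotone (μ := al) (fun n => hFi al ‹_› ha n) hfa
    (ae_of_all _ hFm) (ae_of_all _ hFt)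
  refine le_of_tendsto' h1 fun n => ?_
  exact (h (F n) (hFc n) (fun eta i1 i2 => hFi eta i1 i2 n)).trans
    (integral_mono (hFi be ‹_› hb n) hfb (hFle n))

theorem ecx_of_good (al be : Measure ℝ) [IsFiniteMeasure al] [IsFiniteMeasure be]
    (h : ∀ f : ℝ → ℝ, ConvexOn ℝ univ f → (∀ x, 0 ≤ f x) → (∀ eta : Measure ℝ, IsFiniteMeasure eta →
      Integrable (fun x => x) eta → Integrable f eta) →
      ∫⁻ x, ENNReal.ofReal (f x) ∂al ≤ ∫⁻ x, ENNReal.ofReal (f x) ∂be) :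
    ECx al be := by
  intro f hf hf0
  obtain ⟨F, hFc, hFi, hFm, hFle, hFt⟩ := cx_approx hf
  have h1 := lintegral_tendsto_of_tendsto_of_monotone (μ := al)
    (f := fun n x => ENNReal.ofReal (F n x)) (F := fun x => ENNReal.ofReal (f x))
    (fun n => ((cx_cont (hFc n)).measurable.ennreal_ofReal).aemeasurable)
    (ae_of_all _ fun x m n hmn => ENNReal.ofReal_le_ofReal (hFm x hmn))
    (ae_of_all _ fun x => ENNReal.tendsto_ofReal (hFt x))
  refine le_of_tendsto' h1 fun n => ?_
  have h2 := h (fun x => max (F n x) 0) ((hFc n).sup (convexOn_const 0 convex_univ))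
    (fun x => le_max_right _ _) (fun eta i1 i2 => int_pos_part (hFi eta i1 i2 n))
  refine le_trans (lintegral_mono fun x => ENNReal.ofReal_le_ofReal (le_max_left _ _))
    (h2.trans (lintegral_mono fun x => ENNReal.ofReal_le_ofReal (max_le (hFle n x) (hf0 x))))

theorem lint_of_cx (al be : Measure ℝ) (h : Cx al be) (f : ℝ → ℝ) (hf : ConvexOn ℝ univ f)
    (hf0 : ∀ x, 0 ≤ f x) (ha : Integrable f al) (hb : Integrable f be) :
    ∫⁻ x, ENNReal.ofReal (f x) ∂al ≤ ∫⁻ x, ENNReal.ofReal (f x) ∂be := by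
  rw [← ofReal_integral_eq_lintegral_ofReal ha (ae_of_all _ hf0),
    ← ofReal_integral_eq_lintegral_ofReal hb (ae_of_all _ hf0)]
  exact ENNReal.ofReal_le_ofReal (h f hf ha hb)

theorem one_two (mu nu : Measure ℝ) [IsFiniteMeasure mu] [IsFiniteMeasure nu]
    (hintm : Integrable (fun x => x) mu) (hintn : Integrable (fun x => x) nu) (h : ECx mu nu) :
    ∃ eta : Measure ℝ, IsFiniteMeasure eta ∧ Integrable (fun x => x) eta ∧
        Cx mu eta ∧ eta ≤ nu := by
  obtain ⟨L, hL1, hL2⟩ := exists_functional mu nu h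
  obtain ⟨eta, hle, he⟩ := exists_repr nu L hL1
  have : IsFiniteMeasure eta := isFiniteMeasure_of_le nu hle
  have hi := hintn.mono_measure hle
  refine ⟨eta, ‹_›, hi, ?_, hle⟩
  refine cx_of_good mu eta hintm hi fun f hf hfi => ?_
  rw [← he f (hfi nu ‹_› hintn)]
  exact hL2 f hf (hfi mu ‹_› hintm) (hfi nu ‹_› hintn)

theorem stmt10 (mu nu : Measure ℝ) [IsFiniteMeasure mu] [IsFiniteMeasure nu]
    (hintm : Integrable (fun x => x) mu) (hintn : Integrable (fun x => x) nu) :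
    (ECx mu nu ↔
      ∃ eta : Measure ℝ, IsFiniteMeasure eta ∧ Integrable (fun x => x) eta ∧
        Cx mu eta ∧ eta ≤ nu) ∧
    (ECx mu nu ↔
      ∃ chi : Measure ℝ, IsFiniteMeasure chi ∧ Integrable (fun x => x) chi ∧
        mu ≤ chi ∧ Cx chi nu) := by
  refine ⟨⟨one_two mu nu hintm hintn, ?_⟩, ⟨fun h => ?_, ?_⟩⟩
  · rintro ⟨eta, hfin, hi, hcx, hle⟩
    refine ecx_of_good mu nu fun f hf hf0 hfi => ?_
    exact (lint_of_cx mu eta hcx f hf hf0 (hfi mu ‹_› hintm) (hfi eta ‹_› hi)).trans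
      (lintegral_mono' hle le_rfl)
  · obtain ⟨eta, hfin, hi, hcx, hle⟩ := one_two mu nu hintm hintn h
    have hsub : nu - eta + eta = nu := Measure.sub_add_cancel_of_le hle
    have hle2 : nu - eta ≤ nu := Measure.sub_le
    have : IsFiniteMeasure (nu - eta) := isFiniteMeasure_of_le nu hle2
    have hi2 : Integrable (fun x => x) (nu - eta) := hintn.mono_measure hle2
    refine ⟨mu + (nu - eta), inferInstance, hintm.add_measure hi2,
      Measure.le_add_right le_rfl, ?_⟩
    refine cx_of_good _ _ (hintm.add_measure hi2) hintn fun f hf hfi => ?_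
    have h1 := hcx f hf (hfi mu ‹_› hintm) (hfi eta ‹_› hi)
    rw [integral_add_measure (hfi mu ‹_› hintm) (hfi _ ‹_› hi2)]
    have h2 : ∫ x, f x ∂nu = ∫ x, f x ∂(nu - eta) + ∫ x, f x ∂eta := by
      rw [← integral_add_measure (hfi _ ‹_› hi2) (hfi eta ‹_› hi), hsub]
    linarith
  · rintro ⟨chi, hfin, hi, hle, hcx⟩
    refine ecx_of_good mu nu fun f hf hf0 hfi => ?_
    exact (lintegral_mono' hle le_rfl).trans
      (lint_of_cx chi nu hcx f hf hf0 (hfi chi ‹_› hi) (hfi nu ‹_› hintn))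
end

section
/- Let μ, ν be finite measures on ℝ with finite first moments and μ ≤_E ν. The shadow S^ν(μ), defined as the measure satisfying μ ≤_cx S^ν(μ) ≤ ν which is minimal in convex order among all η with μ ≤_cx η ≤ ν, exists, is unique, and its modified potential satisfies P_{S^ν(μ)} = P_ν - (P_ν - P_μ)^c. -/
open MeasureTheory Set Filter

theorem cvx_cont {f : ℝ → ℝ} (hf : ConvexOn ℝ Set.univ f) : Continuous f :=
  continuousOn_univ.1 (hf.continuousOn isOpen_univ)

noncomputable def rd (f : ℝ → ℝ) (x : ℝ) : ℝ := derivWithin f (Ioi x) x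

theorem rd_has {f : ℝ → ℝ} (hf : ConvexOn ℝ Set.univ f) (x : ℝ) :
    HasDerivWithinAt f (rd f x) (Ioi x) x :=
  hf.hasDerivWithinAt_rightDeriv_of_mem_interior (by simp)

theorem rd_le_slope {f : ℝ → ℝ} (hf : ConvexOn ℝ Set.univ f) {x y : ℝ} (h : x < y) :
    rd f x ≤ (f y - f x) / (y - x) := by
  have := hf.rightDeriv_le_slope_of_mem_interior (x := x) (y := y) (by simp) (by simp) h
  rwa [slope_def_field] at this

theorem rd_mono {f : ℝ → ℝ} (hf : ConvexOn ℝ Set.univ f) : Monotone (rd f) := by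
  have := hf.monotoneOn_rightDeriv
  rw [interior_univ, monotoneOn_univ] at this
  exact this

theorem slope_le_rd {f : ℝ → ℝ} (hf : ConvexOn ℝ Set.univ f) {x y : ℝ} (h : x < y) :
    (f y - f x) / (y - x) ≤ rd f y := by
  have h1 := (hasDerivWithinAt_iff_tendsto_slope' self_notMem_Ioi).mp (rd_has hf y)
  apply ge_of_tendsto h1
  filter_upwards [self_mem_nhdsWithin] with z hz
  rw [slope_def_field]
  exact hf.slope_mono_adjacent (by simp) (by simp) h hz

theorem rd_rcont {f : ℝ → ℝ} (hf : ConvexOn ℝ Set.univ f) (x : ℝ) :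
    ContinuousWithinAt (rd f) (Ici x) x := by
  have h1 := (hasDerivWithinAt_iff_tendsto_slope' self_notMem_Ioi).mp (rd_has hf x)
  rw [ContinuousWithinAt, tendsto_order]
  constructor
  · intro a ha
    filter_upwards [self_mem_nhdsWithin] with z hz
    exact ha.trans_le (rd_mono hf hz)
  · intro a ha
    have h2 := (h1.eventually (gt_mem_nhds ha)).and self_mem_nhdsWithin
    obtain ⟨y, hy, hxy⟩ := h2.exists
    rw [slope_def_field] at hy
    have hxy' : x < y := hxy
    have hc : ContinuousAt (fun z => (f y - f z) / (y - z)) x := by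
      have := (cvx_cont hf).continuousAt (x := x)
      apply ContinuousAt.div (by fun_prop) (by fun_prop)
      linarith
    have h3 := hc.eventually (gt_mem_nhds hy)
    have h4 := nhdsWithin_le_nhds (s := Ici x) (h3.and (gt_mem_nhds hxy'))
    filter_upwards [h4] with z hz
    exact (rd_le_slope hf hz.2).trans_lt hz.1

theorem rd_atBot {f : ℝ → ℝ} (hf : ConvexOn ℝ Set.univ f) (h0 : Tendsto f atBot (nhds 0)) :
    Tendsto (rd f) atBot (nhds 0) := by
  have ha : Tendsto (fun x : ℝ => f x - f (x - 1)) atBot (nhds (0 - 0)) :=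
    h0.sub (h0.comp (tendsto_atBot_add_const_right _ (-1) tendsto_id))
  have hb : Tendsto (fun x : ℝ => f (x + 1) - f x) atBot (nhds (0 - 0)) :=
    (h0.comp (tendsto_atBot_add_const_right _ 1 tendsto_id)).sub h0
  rw [sub_zero] at ha hb
  refine tendsto_of_tendsto_of_tendsto_of_le_of_le ha hb ?_ ?_
  · intro x
    have := slope_le_rd hf (x := x - 1) (y := x) (by linarith)
    simpa using this
  · intro x
    have := rd_le_slope hf (x := x) (y := x + 1) (by linarith)
    simpa using this

theorem rd_nonneg {f : ℝ → ℝ} (hf : ConvexOn ℝ Set.univ f) (h0 : Tendsto f atBot (nhds 0))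
    (x : ℝ) : 0 ≤ rd f x :=
  (rd_mono hf).le_of_tendsto (rd_atBot hf h0) x

theorem lint_layer (S : Measure ℝ) [SFinite S] (k : ℝ) :
    ∫⁻ x, ENNReal.ofReal (max (k - x) 0) ∂S = ∫⁻ t in Iic k, S (Iic t) := by
  have h1 : ∀ x, ENNReal.ofReal (max (k - x) 0)
      = ∫⁻ t in Iic k, (Ici x).indicator (fun _ => 1) t := by
    intro x
    rw [lintegral_indicator_const measurableSet_Ici, one_mul,
      Measure.restrict_apply measurableSet_Ici, Ici_inter_Iic, Real.volume_Icc]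
    rcases le_total (k - x) 0 with h | h
    · rw [max_eq_right h, ENNReal.ofReal_of_nonpos h, ENNReal.ofReal_zero]
    · rw [max_eq_left h]
  have h2 : ∀ t, S (Iic t) = ∫⁻ x, (Ici x).indicator (fun _ => 1) t ∂S := by
    intro t
    rw [← lintegral_indicator_one measurableSet_Iic]
    apply lintegral_congr
    intro x
    simp [indicator]
  simp_rw [h1, h2]
  apply lintegral_lintegral_swap
  have : (Function.uncurry fun x t : ℝ => (Ici x).indicator (fun _ => (1 : ENNReal)) t)
      = {p : ℝ × ℝ | p.1 ≤ p.2}.indicator (fun _ => 1) := by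
    ext ⟨x, t⟩
    simp [indicator]
  rw [this]
  exact (measurable_const.indicator (measurableSet_le measurable_fst measurable_snd)).aemeasurable

theorem rep {f : ℝ → ℝ} (hf : ConvexOn ℝ Set.univ f) (h0 : Tendsto f atBot (nhds 0)) :
    ∃ S : Measure ℝ, SFinite S ∧ (∀ t, S (Iic t) = ENNReal.ofReal (rd f t)) ∧
      ∀ k, ∫⁻ x, ENNReal.ofReal (max (k - x) 0) ∂S = ENNReal.ofReal (f k) := by
  let F : StieltjesFunction ℝ := ⟨rd f, rd_mono hf, rd_rcont hf⟩
  have hI : ∀ t, F.measure (Iic t) = ENNReal.ofReal (rd f t) := by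
    intro t
    rw [F.measure_Iic (l := 0) (rd_atBot hf h0)]
    simp [F]
  refine ⟨F.measure, inferInstance, hI, ?_⟩
  intro k
  rw [lint_layer]
  simp_rw [hI]
  have hii : ∀ a b, IntervalIntegrable (rd f) volume a b :=
    fun a b => (rd_mono hf).intervalIntegrable
  have hFTC : ∀ a, a ≤ k → ∫ t in a..k, rd f t = f k - f a := by
    intro a ha
    exact intervalIntegral.integral_eq_sub_of_hasDeriv_right_of_le ha
      (cvx_cont hf).continuousOn (fun x _ => rd_has hf x) (hii a k)
  have hlim : Tendsto (fun a => f k - f a) atBot (nhds (f k - 0)) := tendsto_const_nhds.sub h0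
  rw [sub_zero] at hlim
  have hlim2 : Tendsto (fun a => ∫ t in a..k, rd f t) atBot (nhds (f k)) := by
    refine hlim.congr' ?_
    filter_upwards [eventually_le_atBot k] with a ha
    exact (hFTC a ha).symm
  have hion : IntegrableOn (rd f) (Iic k) := by
    refine integrableOn_Iic_of_intervalIntegral_norm_tendsto (f k) k
      (a := fun a : ℝ => a) (l := atBot) ?_ tendsto_id ?_
    · intro a
      exact ((rd_mono hf).monotoneOn _).integrableOn_isCompact isCompact_Icc |>.mono_set
        Ioc_subset_Icc_self
    · refine hlim2.congr ?_
      intro a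
      congr 1
      ext t
      rw [Real.norm_of_nonneg (rd_nonneg hf h0 t)]
  have := tendsto_nhds_unique hlim2
    (intervalIntegral_tendsto_integral_Iic k hion tendsto_id)
  rw [this, ofReal_integral_eq_lintegral_ofReal hion]
  exact Eventually.of_forall (rd_nonneg hf h0)

theorem cvx_put (k : ℝ) : ConvexOn ℝ Set.univ (fun x : ℝ => max (k - x) 0) := by
  refine ConvexOn.sup ⟨convex_univ, ?_⟩ (convexOn_const 0 convex_univ)
  intro x _ y _ a b _ _ hab
  simp only [smul_eq_mul]
  have : a * k + b * k = k := by rw [← add_mul, hab, one_mul]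
  nlinarith

theorem cvx_call (k : ℝ) : ConvexOn ℝ Set.univ (fun x : ℝ => max (x - k) 0) := by
  refine ConvexOn.sup ⟨convex_univ, ?_⟩ (convexOn_const 0 convex_univ)
  intro x _ y _ a b _ _ hab
  simp only [smul_eq_mul]
  have : a * k + b * k = k := by rw [← add_mul, hab, one_mul]
  nlinarith

theorem int_put (m : Measure ℝ) [IsFiniteMeasure m] (h : Integrable (fun x => x) m) (k : ℝ) :
    Integrable (fun x : ℝ => max (k - x) 0) m :=
  ((integrable_const k).sub h).pos_part

theorem int_call (m : Measure ℝ) [IsFiniteMeasure m] (h : Integrable (fun x => x) m) (k : ℝ) :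
    Integrable (fun x : ℝ => max (x - k) 0) m :=
  (h.sub (integrable_const k)).pos_part

theorem pot_cpot (m : Measure ℝ) [IsFiniteMeasure m] (h : Integrable (fun x => x) m) (k : ℝ) :
    pot m k = m.real univ * k - (∫ x, x ∂m) + cpot m k := by
  have h1 : ∀ x : ℝ, max (k - x) 0 = k - x + max (x - k) 0 := by
    intro x
    rcases le_total x k with h | h
    · rw [max_eq_left (by linarith), max_eq_right (by linarith), add_zero]
    · rw [max_eq_right (by linarith), max_eq_left (by linarith)]; ring
  unfold pot cpot
  simp_rw [h1]
  have h2 : Integrable (fun x : ℝ => k - x) m := (integrable_const k).sub h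
  rw [integral_add h2 (int_call m h k), integral_sub (integrable_const k) h]
  simp

theorem pot_convex (m : Measure ℝ) [IsFiniteMeasure m] (h : Integrable (fun x => x) m) :
    ConvexOn ℝ Set.univ (pot m) := by
  refine ⟨convex_univ, ?_⟩
  intro x _ y _ a b ha hb hab
  simp only [smul_eq_mul, pot]
  rw [← integral_const_mul, ← integral_const_mul, ← integral_add
    ((int_put m h x).const_mul a) ((int_put m h y).const_mul b)]
  apply integral_mono (int_put m h _)
    (((int_put m h x).const_mul a).add ((int_put m h y).const_mul b))
  intro z
  have := (cvx_call z).2 (mem_univ x) (mem_univ y) ha hb hab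
  simpa using this

theorem pot_atBot (m : Measure ℝ) [IsFiniteMeasure m] (h : Integrable (fun x => x) m) :
    Tendsto (pot m) atBot (nhds 0) := by
  have : Tendsto (fun k => ∫ x, max (k - x) 0 ∂m) atBot (nhds (∫ x, (0 : ℝ) ∂m)) := by
    apply tendsto_integral_filter_of_dominated_convergence (fun x : ℝ => max (0 - x) 0)
    · exact Eventually.of_forall fun k => (int_put m h k).aestronglyMeasurable
    · filter_upwards [eventually_le_atBot 0] with k hk
      refine Eventually.of_forall fun x => ?_
      rw [Real.norm_of_nonneg (le_max_right _ _)]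
      exact max_le_max (by linarith) le_rfl
    · exact int_put m h 0
    · refine Eventually.of_forall fun x => ?_
      apply tendsto_const_nhds.congr'
      filter_upwards [eventually_le_atBot x] with k hk
      rw [max_eq_right (by linarith)]
  rw [integral_zero] at this
  exact this

theorem cpot_atTop (m : Measure ℝ) [IsFiniteMeasure m] (h : Integrable (fun x => x) m) :
    Tendsto (cpot m) atTop (nhds 0) := by
  have : Tendsto (fun k => ∫ x, max (x - k) 0 ∂m) atTop (nhds (∫ x, (0 : ℝ) ∂m)) := by
    apply tendsto_integral_filter_of_dominated_convergence (fun x : ℝ => max (x - 0) 0)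
    · exact Eventually.of_forall fun k => (int_call m h k).aestronglyMeasurable
    · filter_upwards [eventually_ge_atTop 0] with k hk
      refine Eventually.of_forall fun x => ?_
      rw [Real.norm_of_nonneg (le_max_right _ _)]
      exact max_le_max (by linarith) le_rfl
    · exact int_call m h 0
    · refine Eventually.of_forall fun x => ?_
      apply tendsto_const_nhds.congr'
      filter_upwards [eventually_ge_atTop x] with k hk
      rw [max_eq_right (by linarith)]
  rw [integral_zero] at this
  exact this

theorem pot_deriv (m : Measure ℝ) [IsFiniteMeasure m] (h : Integrable (fun x => x) m) (k : ℝ) :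
    HasDerivWithinAt (pot m) (m.real (Iic k)) (Ioi k) k := by
  rw [hasDerivWithinAt_iff_tendsto_slope' self_notMem_Ioi]
  have hs : ∀ y, slope (pot m) k y
      = ∫ x, (max (y - x) 0 - max (k - x) 0) / (y - k) ∂m := by
    intro y
    rw [slope_def_field, integral_div, integral_sub (int_put m h y) (int_put m h k)]
    rfl
  have h1 : m.real (Iic k) = ∫ x, (Iic k).indicator (fun _ => (1 : ℝ)) x ∂m := by
    rw [integral_indicator_const _ measurableSet_Iic]; simp
  rw [h1]
  simp_rw [funext hs]
  apply tendsto_integral_filter_of_dominated_convergence (fun _ : ℝ => (1 : ℝ))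
  · exact Eventually.of_forall fun y =>
      (((int_put m h y).sub (int_put m h k)).div_const _).aestronglyMeasurable
  · filter_upwards [self_mem_nhdsWithin] with y hy
    have hy' : k < y := hy
    refine Eventually.of_forall fun x => ?_
    rw [Real.norm_eq_abs, abs_div, abs_of_pos (sub_pos.2 hy'), div_le_one (sub_pos.2 hy'), abs_le]
    constructor
    · rcases max_cases (y - x) 0 with h | h <;> rcases max_cases (k - x) 0 with h' | h' <;> linarith
    · rcases max_cases (y - x) 0 with h | h <;> rcases max_cases (k - x) 0 with h' | h' <;> linarith
  · exact integrable_const _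
  · refine Eventually.of_forall fun x => ?_
    apply tendsto_const_nhds.congr'
    by_cases hx : x ≤ k
    · filter_upwards [self_mem_nhdsWithin] with y hy
      have hy' : k < y := hy
      rw [indicator_of_mem (show x ∈ Iic k from hx), max_eq_left (by linarith),
        max_eq_left (by linarith)]
      rw [eq_div_iff (by linarith)]; ring
    · have hx' : k < x := not_le.1 hx
      filter_upwards [nhdsWithin_le_nhds (gt_mem_nhds hx')] with y hy
      rw [indicator_of_notMem (show x ∉ Iic k from hx), max_eq_right (by linarith),
        max_eq_right (by linarith)]
      simp

theorem pot_inj (m n : Measure ℝ) [IsFiniteMeasure m] [IsFiniteMeasure n]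
    (hm : Integrable (fun x => x) m) (hn : Integrable (fun x => x) n)
    (h : ∀ k, pot m k = pot n k) : m = n := by
  apply Measure.ext_of_Iic
  intro k
  have h1 := pot_deriv m hm k
  rw [funext h] at h1
  have h2 := (uniqueDiffWithinAt_Ioi k).eq_deriv _ h1 (pot_deriv n hn k)
  exact (measureReal_eq_measureReal_iff).1 h2

theorem hull_exists (h : ℝ → ℝ) (h0 : ∀ x, 0 ≤ h x) : ∃ c, IsConvexHull h c := by
  let A : ℝ → Set ℝ := fun x => {r | ∃ g : ℝ → ℝ, ConvexOn ℝ Set.univ g ∧ (∀ x, g x ≤ h x) ∧ r = g x}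
  have hne : ∀ x, (A x).Nonempty := fun x => ⟨0, fun _ => 0, convexOn_const 0 convex_univ, h0, rfl⟩
  have hbd : ∀ x, BddAbove (A x) := by
    rintro x
    refine ⟨h x, ?_⟩
    rintro r ⟨g, _, hg, rfl⟩
    exact hg x
  refine ⟨fun x => sSup (A x), ⟨convex_univ, ?_⟩, ?_, ?_⟩
  · intro x _ y _ a b ha hb hab
    apply csSup_le (hne _)
    rintro r ⟨g, hg, hgh, rfl⟩
    refine (hg.2 (mem_univ x) (mem_univ y) ha hb hab).trans ?_
    simp only [smul_eq_mul]
    have h1 : g x ≤ sSup (A x) := le_csSup (hbd x) ⟨g, hg, hgh, rfl⟩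
    have h2 : g y ≤ sSup (A y) := le_csSup (hbd y) ⟨g, hg, hgh, rfl⟩
    exact add_le_add (mul_le_mul_of_nonneg_left h1 ha) (mul_le_mul_of_nonneg_left h2 hb)
  · intro x
    apply csSup_le (hne _)
    rintro r ⟨g, hg, hgh, rfl⟩
    exact hgh x
  · intro g hg hgh x
    exact le_csSup (hbd x) ⟨g, hg, hgh, rfl⟩

theorem affine_convex (p q : ℝ) : ConvexOn ℝ Set.univ (fun t : ℝ => p * t + q) := by
  refine ⟨convex_univ, ?_⟩
  intro x _ y _ a b _ _ hab
  simp only [smul_eq_mul]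
  have : a * q + b * q = q := by rw [← add_mul, hab, one_mul]
  nlinarith

theorem cvx_mid {f : ℝ → ℝ} (hf : ConvexOn ℝ Set.univ f) (x e : ℝ) :
    f x ≤ (f (x - e) + f (x + e)) / 2 := by
  have := hf.2 (mem_univ (x - e)) (mem_univ (x + e)) (show (0 : ℝ) ≤ 1 / 2 by norm_num)
    (show (0 : ℝ) ≤ 1 / 2 by norm_num) (by norm_num)
  simp only [smul_eq_mul] at this
  have h2 : 1 / 2 * (x - e) + 1 / 2 * (x + e) = x := by ring
  rw [h2] at this
  linarith

/-- Outside a chord interval, a convex function lies above the chord. -/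
theorem chord_le {c : ℝ → ℝ} (hc : ConvexOn ℝ Set.univ c) {a b t : ℝ} (hab : a < b)
    (ht : t < a ∨ b < t) : c a + (c b - c a) / (b - a) * (t - a) ≤ c t := by
  rcases ht with ht | ht
  · have := hc.slope_mono_adjacent (mem_univ t) (mem_univ b) ht hab
    rw [div_le_iff₀ (by linarith)] at this
    linarith
  · have := hc.slope_mono_adjacent (mem_univ a) (mem_univ t) hab ht
    rw [le_div_iff₀ (by linarith)] at this
    have h2 : (c b - c a) / (b - a) * (b - a) = c b - c a := div_mul_cancel₀ _ (by linarith)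
    linarith

theorem hull_mid {h c : ℝ → ℝ} (hh : Continuous h) (hc : IsConvexHull h c) {x : ℝ}
    (hx : c x < h x) : ∃ e0 > 0, ∀ e, 0 < e → e < e0 → c x = (c (x - e) + c (x + e)) / 2 := by
  obtain ⟨q, hq1, hq2⟩ := exists_between hx
  have hcc := cvx_cont hc.1
  have h1 : ∀ᶠ t in nhds x, c t < q := hcc.continuousAt.eventually (gt_mem_nhds hq1)
  have h2 : ∀ᶠ t in nhds x, q < h t := hh.continuousAt.eventually (lt_mem_nhds hq2)
  obtain ⟨e0, he0, hball⟩ := Metric.eventually_nhds_iff.1 (h1.and h2)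
  refine ⟨e0, he0, ?_⟩
  intro e he hee
  apply le_antisymm (cvx_mid hc.1 x e)
  set a := x - e with ha
  set b := x + e with hb
  have hin : ∀ t, a ≤ t → t ≤ b → c t < q ∧ q < h t := by
    intro t h1 h2
    apply hball
    rw [Real.dist_eq, abs_lt]
    constructor <;> linarith
  have hab : a < b := by linarith
  set s := (c b - c a) / (b - a) with hs
  have hsb : s * (b - a) = c b - c a := div_mul_cancel₀ _ (by linarith)
  have hL : ConvexOn ℝ Set.univ (fun t => s * t + (c a - s * a)) := affine_convex _ _
  have hmax := hc.2.2 _ (hc.1.sup hL) (by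
    intro t
    apply sup_le (hc.2.1 t)
    by_cases ht : t < a ∨ b < t
    · have := chord_le hc.1 hab ht
      have h3 := hc.2.1 t
      rw [← hs] at this
      linarith
    · push Not at ht
      have h3 := hin t ht.1 ht.2
      have h4 := hin a le_rfl hab.le
      have h5 := hin b hab.le le_rfl
      rcases le_total 0 s with h6 | h6
      · nlinarith [mul_le_mul_of_nonneg_left ht.2 h6]
      · nlinarith [mul_le_mul_of_nonpos_left ht.1 h6]) x
  have h7 : s * x + (c a - s * a) ≤ c x := le_trans le_sup_right hmax
  have h8 : s * (b - a) = 2 * (s * x - s * a) := by rw [ha, hb]; ring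
  linarith

theorem key {f g c : ℝ → ℝ} (hf : ConvexOn ℝ Set.univ f) (hg : ConvexOn ℝ Set.univ g)
    (hc : IsConvexHull (fun x => f x - g x) c) : ConvexOn ℝ Set.univ (fun x => f x - c x) := by
  have hfc := cvx_cont hf
  have hgc := cvx_cont hg
  have hcc := cvx_cont hc.1
  -- local midpoint inequality
  have hloc : ∀ x0 p q : ℝ, ∀ r > 0, (∀ t, |t - x0| < r → f t - c t - (p * t + q)
      ≤ f x0 - c x0 - (p * x0 + q)) → ∃ t, t < x0 ∧ |t - x0| < r ∧
      f t - c t - (p * t + q) = f x0 - c x0 - (p * x0 + q) := by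
    intro x0 p q r hr hmax
    have hfin : ∀ e, 0 < e → e < r → f x0 - c x0 ≤
        ((f (x0 - e) - c (x0 - e)) + (f (x0 + e) - c (x0 + e))) / 2 → ∃ t, t < x0 ∧ |t - x0| < r ∧
      f t - c t - (p * t + q) = f x0 - c x0 - (p * x0 + q) := by
      intro e he her hle
      have h1 := hmax (x0 + e) (by rw [add_sub_cancel_left, abs_of_pos he]; exact her)
      have hr' : |x0 - e - x0| < r := by
        rw [show x0 - e - x0 = -e by ring, abs_neg, abs_of_pos he]; exact her
      have h2 := hmax (x0 - e) hr'
      refine ⟨x0 - e, by linarith, hr', ?_⟩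
      apply le_antisymm h2
      nlinarith
    rcases (hc.2.1 x0).lt_or_eq with hlt | heq
    · obtain ⟨e0, he0, hmid⟩ := hull_mid (by fun_prop) hc hlt
      have hm : 0 < min e0 r := lt_min he0 hr
      have h1 := min_le_left e0 r
      have h2 := min_le_right e0 r
      apply hfin (min e0 r / 2) (by linarith) (by linarith)
      have h3 := hmid (min e0 r / 2) (by linarith) (by linarith)
      have h4 := cvx_mid hf x0 (min e0 r / 2)
      linarith
    · apply hfin (r / 2) (by linarith) (by linarith)
      have h4 := cvx_mid hg x0 (r / 2)
      have h5 := hc.2.1 (x0 - r / 2)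
      have h6 := hc.2.1 (x0 + r / 2)
      simp only at heq h5 h6
      linarith
  have claim : ∀ p q x y : ℝ, f x - c x ≤ p * x + q → f y - c y ≤ p * y + q →
      ∀ z, x ≤ z → z ≤ y → f z - c z ≤ p * z + q := by
    intro p q x y hx hy z hxz hzy
    by_contra hcon
    push Not at hcon
    let u : ℝ → ℝ := fun t => f t - c t - (p * t + q)
    have hu : Continuous u := by fun_prop
    obtain ⟨w, hw, hwmax⟩ := isCompact_Icc.exists_isMaxOn (⟨z, hxz, hzy⟩ : (Icc x y).Nonempty)
      hu.continuousOn
    have hK : IsCompact (Icc x y ∩ u ⁻¹' {u w}) :=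
      isCompact_Icc.inter_right (isClosed_singleton.preimage hu)
    obtain ⟨x0, ⟨hx0, hx0w⟩, hleast⟩ := hK.exists_isLeast ⟨w, hw, rfl⟩
    have hx0w' : u x0 = u w := hx0w
    have hpos : 0 < u x0 := by
      have h1 : u z ≤ u w := hwmax ⟨hxz, hzy⟩
      have h2 : 0 < u z := by simp only [u]; linarith
      linarith
    have hxx : x < x0 := by
      rcases hx0.1.lt_or_eq with h | h
      · exact h
      · rw [← h] at hpos; simp only [u] at hpos; linarith
    have hyy : x0 < y := by
      rcases hx0.2.lt_or_eq with h | h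
      · exact h
      · rw [h] at hpos; simp only [u] at hpos; linarith
    have hIn : ∀ t, |t - x0| < min (x0 - x) (y - x0) → t ∈ Icc x y := by
      intro t ht
      rw [abs_lt] at ht
      have h1 := min_le_left (x0 - x) (y - x0)
      have h2 := min_le_right (x0 - x) (y - x0)
      constructor <;> linarith [ht.1, ht.2]
    obtain ⟨t, ht1, ht2, ht3⟩ := hloc x0 p q (min (x0 - x) (y - x0))
      (lt_min (by linarith) (by linarith)) (by
        intro t ht
        have h1 : u t ≤ u w := hwmax (hIn t ht)
        rw [← hx0w'] at h1
        exact h1)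
    have : x0 ≤ t := hleast ⟨hIn t ht2, by
      have : u t = u x0 := ht3
      rw [mem_preimage, this, hx0w']; rfl⟩
    linarith
  refine LinearOrder.convexOn_of_lt convex_univ ?_
  intro x _ y _ hxy a b ha hb hab
  simp only [smul_eq_mul]
  set X := f x - c x with hX
  set Y := f y - c y with hY
  set p := (Y - X) / (y - x) with hp
  have hpy : p * (y - x) = Y - X := div_mul_cancel₀ _ (by linarith)
  have hb' : b = 1 - a := by linarith
  have := claim p (X - p * x) x y (by linarith) (by linarith) (a * x + b * y)
    (by subst hb'; nlinarith) (by subst hb'; nlinarith)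
  refine this.trans (le_of_eq ?_)
  have e : p * (a * x + b * y) + (X - p * x) = b * (p * (y - x)) + X := by subst hb'; ring
  rw [e, hpy, hb']; ring

theorem mono_lint {g : ℝ → ℝ} (hg : ConvexOn ℝ Set.univ g) (hg0 : ∀ x, 0 ≤ g x) (h0 : g 0 = 0)
    (α β : Measure ℝ) [SFinite α] [SFinite β] {u : ℝ → ℝ} (hu : Measurable u)
    (h : ∀ k, ∫⁻ x, ENNReal.ofReal (max (u x - k) 0) ∂α
      ≤ ∫⁻ x, ENNReal.ofReal (max (u x - k) 0) ∂β) :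
    ∫⁻ x, ENNReal.ofReal (g (max (u x) 0)) ∂α ≤ ∫⁻ x, ENNReal.ofReal (g (max (u x) 0)) ∂β := by
  have hmono : ∀ s w, 0 ≤ s → s ≤ w → g s ≤ g w := by
    intro s w hs hsw
    have := hg.le_max_of_mem_Icc (mem_univ 0) (mem_univ w) (z := s) ⟨hs, hsw⟩
    rwa [h0, max_eq_right (hg0 w)] at this
  have hG : ConvexOn ℝ Set.univ (fun x => g (max x 0)) := by
    refine ⟨convex_univ, ?_⟩
    intro x _ y _ a b ha hb hab
    refine le_trans ?_ (hg.2 (mem_univ (max x 0)) (mem_univ (max y 0)) ha hb hab)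
    apply hmono _ _ (le_max_right _ _)
    have := (cvx_call 0).2 (mem_univ x) (mem_univ y) ha hb hab
    simpa using this
  have hlim : Tendsto (fun x => g (max x 0)) atBot (nhds 0) := by
    apply tendsto_const_nhds.congr'
    filter_upwards [eventually_le_atBot 0] with x hx
    rw [max_eq_right hx, h0]
  obtain ⟨T, hT, -, hrep⟩ := rep hG hlim
  have hsw : ∀ m : Measure ℝ, SFinite m → ∫⁻ x, ENNReal.ofReal (g (max (u x) 0)) ∂m
      = ∫⁻ k, ∫⁻ x, ENNReal.ofReal (max (u x - k) 0) ∂m ∂T := by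
    intro m hm
    simp_rw [← hrep]
    apply lintegral_lintegral_swap
    apply Measurable.aemeasurable
    unfold Function.uncurry
    fun_prop
  rw [hsw α inferInstance, hsw β inferInstance]
  exact lintegral_mono h

theorem lint_pot (m : Measure ℝ) [IsFiniteMeasure m] (h : Integrable (fun x => x) m) (k : ℝ) :
    ∫⁻ x, ENNReal.ofReal (max (k - x) 0) ∂m = ENNReal.ofReal (pot m k) :=
  (ofReal_integral_eq_lintegral_ofReal (int_put m h k)
    (Eventually.of_forall fun _ => le_max_right _ _)).symm

theorem lint_cpot (m : Measure ℝ) [IsFiniteMeasure m] (h : Integrable (fun x => x) m) (k : ℝ) :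
    ∫⁻ x, ENNReal.ofReal (max (x - k) 0) ∂m = ENNReal.ofReal (cpot m k) :=
  (ofReal_integral_eq_lintegral_ofReal (int_call m h k)
    (Eventually.of_forall fun _ => le_max_right _ _)).symm

theorem cx_of_pot (α β : Measure ℝ) [IsFiniteMeasure α] [IsFiniteMeasure β]
    (hα : Integrable (fun x => x) α) (hβ : Integrable (fun x => x) β)
    (hmass : α.real univ = β.real univ) (hmean : ∫ x, x ∂α = ∫ x, x ∂β)
    (hp : ∀ k, pot α k ≤ pot β k) : Cx α β := by
  intro f hf hfα hfβ
  let g : ℝ → ℝ := fun x => f x + ((-rd f 0) * x + (-f 0))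
  have hg : ConvexOn ℝ Set.univ g := hf.add (affine_convex _ _)
  have h0 : g 0 = 0 := by simp [g]
  have hg0 : ∀ x, 0 ≤ g x := by
    intro x
    rcases lt_trichotomy x 0 with h | h | h
    · have := slope_le_rd hf h
      rw [div_le_iff₀ (by linarith)] at this
      simp only [g]; linarith
    · rw [h, h0]
    · have := rd_le_slope hf h
      rw [le_div_iff₀ (by linarith)] at this
      simp only [g]; linarith
  have hgn : ConvexOn ℝ Set.univ (fun x => g (-x)) := by
    refine ⟨convex_univ, ?_⟩
    intro x _ y _ a b ha hb hab
    have := hg.2 (mem_univ (-x)) (mem_univ (-y)) ha hb hab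
    simp only [smul_eq_mul] at this ⊢
    rwa [show -(a * x + b * y) = a * -x + b * -y by ring]
  have hcall : ∀ k, cpot α k ≤ cpot β k := by
    intro k
    have := hp k
    rw [pot_cpot α hα, pot_cpot β hβ, hmass, hmean] at this
    linarith
  have i1 := mono_lint hg hg0 h0 α β measurable_id (by
    intro k
    simp only [id]
    rw [lint_cpot α hα, lint_cpot β hβ]
    exact ENNReal.ofReal_le_ofReal (hcall k))
  have i2 := mono_lint hgn (fun x => hg0 _) (by simpa using h0) α β measurable_neg (by
    intro k
    have e : ∀ x : ℝ, -x - k = -k - x := fun x => by ring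
    simp only [e]
    rw [lint_pot α hα, lint_pot β hβ]
    exact ENNReal.ofReal_le_ofReal (hp (-k)))
  have hgc := cvx_cont hg
  have split : ∀ m : Measure ℝ, ∫⁻ x, ENNReal.ofReal (g x) ∂m
      = ∫⁻ x, ENNReal.ofReal (g (max (id x) 0)) ∂m
        + ∫⁻ x, ENNReal.ofReal (g (-(max (-x) 0))) ∂m := by
    intro m
    rw [← lintegral_add_left (by fun_prop)]
    apply lintegral_congr
    intro x
    simp only [id]
    rcases le_total x 0 with h | h
    · rw [max_eq_right h, max_eq_left (by linarith), h0, neg_neg]; simp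
    · rw [max_eq_left h, max_eq_right (by linarith), neg_zero, h0]; simp
  have i3 : ∫⁻ x, ENNReal.ofReal (g x) ∂α ≤ ∫⁻ x, ENNReal.ofReal (g x) ∂β := by
    rw [split α, split β]
    exact add_le_add i1 i2
  have hii : ∀ m : Measure ℝ, IsFiniteMeasure m → Integrable (fun x => x) m → Integrable f m →
      Integrable g m ∧ ∫ x, g x ∂m
        = ∫ x, f x ∂m + ((-rd f 0) * (∫ x, x ∂m) + m.real univ * (-f 0)) := by
    intro m _ hm hfm
    have a1 := hm.const_mul (-rd f 0)
    have a2 : Integrable (fun _ : ℝ => -f 0) m := integrable_const _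
    have a3 : Integrable (fun x : ℝ => (-rd f 0) * x + (-f 0)) m := a1.add a2
    refine ⟨hfm.add a3, ?_⟩
    simp only [g]
    rw [integral_add hfm a3, integral_add a1 a2, integral_const_mul, integral_const]
    rfl
  obtain ⟨gα, eα⟩ := hii α inferInstance hα hfα
  obtain ⟨gβ, eβ⟩ := hii β inferInstance hβ hfβ
  rw [← ofReal_integral_eq_lintegral_ofReal gα (Eventually.of_forall hg0),
    ← ofReal_integral_eq_lintegral_ofReal gβ (Eventually.of_forall hg0),
    ENNReal.ofReal_le_ofReal_iff (integral_nonneg hg0), eα, eβ, hmass, hmean] at i3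
  linarith

theorem cx_facts (α β : Measure ℝ) [IsFiniteMeasure α] [IsFiniteMeasure β]
    (hα : Integrable (fun x => x) α) (hβ : Integrable (fun x => x) β) (h : Cx α β) :
    α.real univ = β.real univ ∧ (∫ x, x ∂α = ∫ x, x ∂β) ∧ ∀ k, pot α k ≤ pot β k := by
  refine ⟨le_antisymm ?_ ?_, le_antisymm ?_ ?_, ?_⟩
  · simpa using h (fun _ => 1) (convexOn_const 1 convex_univ) (integrable_const _)
      (integrable_const _)
  · simpa using h (fun _ => -1) (convexOn_const (-1) convex_univ) (integrable_const _)
      (integrable_const _)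
  · exact h (fun x => x) (convexOn_id convex_univ) hα hβ
  · have := h (fun x => -x) (by simpa using affine_convex (-1) 0) hα.neg hβ.neg
    rw [integral_neg, integral_neg] at this
    linarith
  · intro k
    exact h _ (cvx_put k) (int_put α hα k) (int_put β hβ k)

theorem pot_sub_convex (η ν : Measure ℝ) [IsFiniteMeasure ν] (hν : Integrable (fun x => x) ν)
    (h : η ≤ ν) : ConvexOn ℝ Set.univ (fun k => pot ν k - pot η k) := by
  have : IsFiniteMeasure η := isFiniteMeasure_of_le ν h
  have hs : ν - η ≤ ν := Measure.sub_le
  have hi := hν.mono_measure hs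
  have e : (fun k => pot ν k - pot η k) = pot (ν - η) := by
    ext k
    have h1 : pot ν k = pot (ν - η + η) k := by rw [Measure.sub_add_cancel_of_le h]
    rw [h1]
    unfold pot
    rw [integral_add_measure (int_put _ hi k) (int_put _ (hν.mono_measure h) k)]
    ring
  rw [e]
  have : IsFiniteMeasure (ν - η) := isFiniteMeasure_of_le ν hs
  exact pot_convex _ hi

theorem lin_zero {a b : ℝ} (h : Tendsto (fun k : ℝ => a * k - b) atTop (nhds 0)) :
    a = 0 ∧ b = 0 := by
  have h1 : Tendsto (fun k : ℝ => (a * (k + 1) - b) - (a * k - b)) atTop (nhds (0 - 0)) :=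
    (h.comp (tendsto_atTop_add_const_right _ 1 tendsto_id)).sub h
  have e : (fun k : ℝ => (a * (k + 1) - b) - (a * k - b)) = fun _ => a := by ext k; ring
  rw [e, sub_zero] at h1
  have ha : a = 0 := tendsto_nhds_unique tendsto_const_nhds h1
  subst ha
  refine ⟨rfl, ?_⟩
  simp only [zero_mul, zero_sub] at h
  have := tendsto_nhds_unique tendsto_const_nhds h
  linarith

theorem stmt14 (mu nu : Measure ℝ) [IsFiniteMeasure mu] [IsFiniteMeasure nu]
    (hintm : Integrable (fun x => x) mu) (hintn : Integrable (fun x => x) nu)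
    (hE : ECx mu nu) :
    (∃! S : Measure ℝ, IsShadow mu nu S) ∧
    (∀ (S : Measure ℝ) (c : ℝ → ℝ), IsShadow mu nu S →
      IsConvexHull (fun k => pot nu k - pot mu k) c →
      ∀ k, pot S k = pot nu k - c k) := by 
  have hpot : ∀ k, pot mu k ≤ pot nu k := by
    intro k
    have h1 := hE _ (cvx_put k) (fun _ => le_max_right _ _)
    rw [lint_pot mu hintm, lint_pot nu hintn] at h1
    exact (ENNReal.ofReal_le_ofReal_iff (integral_nonneg fun _ => le_max_right _ _)).1 h1
  have hcpot : ∀ k, cpot mu k ≤ cpot nu k := by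
    intro k
    have h1 := hE _ (cvx_call k) (fun _ => le_max_right _ _)
    rw [lint_cpot mu hintm, lint_cpot nu hintn] at h1
    exact (ENNReal.ofReal_le_ofReal_iff (integral_nonneg fun _ => le_max_right _ _)).1 h1
  obtain ⟨c, hc⟩ := hull_exists (fun k => pot nu k - pot mu k)
    (fun k => sub_nonneg.2 (hpot k))
  have hc0 : ∀ k, 0 ≤ c k := hc.2.2 (fun _ => 0) (convexOn_const 0 convex_univ)
    (fun k => sub_nonneg.2 (hpot k))
  have hmu0 : ∀ k, 0 ≤ pot mu k := fun k => integral_nonneg fun _ => le_max_right _ _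
  have hcle : ∀ k, c k ≤ pot nu k - pot mu k := hc.2.1
  have hphi := key (pot_convex nu hintn) (pot_convex mu hintm) hc
  have hphi0 : ∀ k, 0 ≤ pot nu k - c k := fun k => by linarith [hcle k, hmu0 k]
  have hnuB := pot_atBot nu hintn
  have hcB : Tendsto c atBot (nhds 0) :=
    tendsto_of_tendsto_of_tendsto_of_le_of_le tendsto_const_nhds hnuB hc0
      (fun k => by linarith [hcle k, hmu0 k])
  have hphiB : Tendsto (fun k => pot nu k - c k) atBot (nhds 0) := by
    simpa using hnuB.sub hcB
  obtain ⟨S, hSs, hSI, hSp⟩ := rep hphi hphiB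
  obtain ⟨T, hTs, hTI, hTp⟩ := rep hc.1 hcB
  have hsum : nu = S + T := by
    apply Measure.ext_of_Iic
    intro t
    rw [Measure.add_apply, hSI, hTI, ← ENNReal.ofReal_add (rd_nonneg hphi hphiB t)
      (rd_nonneg hc.1 hcB t)]
    have h1 := (rd_has hphi t).add (rd_has hc.1 t)
    have e : ((fun k => pot nu k - c k) + c) = pot nu := by
      ext k; simp
    rw [e] at h1
    rw [← (uniqueDiffWithinAt_Ioi t).eq_deriv _ (pot_deriv nu hintn t) h1]
    exact (ofReal_measureReal).symm
  have hSle : S ≤ nu := by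
    rw [hsum]
    exact Measure.le_add_right le_rfl
  have hSfin : IsFiniteMeasure S := isFiniteMeasure_of_le nu hSle
  have hSint : Integrable (fun x => x) S := hintn.mono_measure hSle
  have hSpot : ∀ k, pot S k = pot nu k - c k := by
    intro k
    have h1 := hSp k
    rw [lint_pot S hSint] at h1
    exact (ENNReal.ofReal_eq_ofReal_iff (integral_nonneg fun _ => le_max_right _ _)
      (hphi0 k)).1 h1
  -- mass and mean
  have hclow : ∀ k, (nu.real univ - mu.real univ) * k + ((∫ x, x ∂mu) - ∫ x, x ∂nu) ≤ c k := by
    refine hc.2.2 _ (affine_convex _ _) ?_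
    intro k
    have := hcpot k
    simp only
    rw [pot_cpot nu hintn, pot_cpot mu hintm]
    linarith
  have hmm : Tendsto (fun k => (S.real univ - mu.real univ) * k
      - ((∫ x, x ∂S) - ∫ x, x ∂mu)) atTop (nhds 0) := by
    have t1 := cpot_atTop mu hintm
    have t2 := cpot_atTop nu hintn
    have t3 := cpot_atTop S hSint
    have t4 : Tendsto (fun k => cpot mu k - cpot S k) atTop (nhds 0) := by simpa using t1.sub t3
    have t5 : Tendsto (fun k => cpot nu k - cpot S k) atTop (nhds 0) := by simpa using t2.sub t3
    refine tendsto_of_tendsto_of_tendsto_of_le_of_le t4 t5 ?_ ?_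
    · intro k
      have h1 := hSpot k
      have h2 := hcle k
      rw [pot_cpot S hSint] at h1
      rw [pot_cpot mu hintm] at h2
      simp only
      linarith
    · intro k
      have h1 := hSpot k
      have h2 := hclow k
      rw [pot_cpot S hSint, pot_cpot nu hintn] at h1
      simp only
      linarith
  obtain ⟨hm1, hm2⟩ := lin_zero hmm
  have hmass : mu.real univ = S.real univ := by linarith
  have hmean : ∫ x, x ∂mu = ∫ x, x ∂S := by linarith
  have hSh : IsShadow mu nu S := by
    refine ⟨?_, hSle, ?_⟩
    · apply cx_of_pot mu S hintm hSint hmass hmean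
      intro k
      rw [hSpot]
      linarith [hcle k]
    · intro eta h1 h2
      have hef : IsFiniteMeasure eta := isFiniteMeasure_of_le nu h2
      have hei : Integrable (fun x => x) eta := hintn.mono_measure h2
      obtain ⟨e1, e2, e3⟩ := cx_facts mu eta hintm hei h1
      apply cx_of_pot S eta hSint hei (hmass.symm.trans e1) (hmean.symm.trans e2)
      intro k
      have := hc.2.2 _ (pot_sub_convex eta nu hintn h2) (fun k => by
        have := e3 k
        simp only
        linarith) k
      rw [hSpot]
      linarith
  have huniq : ∀ S', IsShadow mu nu S' → S' = S := by
    intro S' h'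
    have hef : IsFiniteMeasure S' := isFiniteMeasure_of_le nu h'.2.1
    have hei : Integrable (fun x => x) S' := hintn.mono_measure h'.2.1
    apply pot_inj S' S hei hSint
    intro k
    exact le_antisymm ((cx_facts S' S hei hSint (h'.2.2 S hSh.1 hSh.2.1)).2.2 k)
      ((cx_facts S S' hSint hei (hSh.2.2 S' h'.1 h'.2.1)).2.2 k)
  refine ⟨⟨S, hSh, huniq⟩, ?_⟩
  intro S' c' hS' hc' k
  rw [huniq S' hS', hSpot]
  have : c k = c' k := le_antisymm (hc'.2.2 c hc.1 hc.2.1 k) (hc.2.2 c' hc'.1 hc'.2.1 k)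
  rw [this]
end

section
/- (Associativity of the shadow) Let μ₁, μ₂, ν be finite measures on ℝ with finite first moments and μ₁ + μ₂ ≤_E ν. Then S^ν(μ₁+μ₂) = S^ν(μ₁) + S^{ν - S^ν(μ₁)}(μ₂). -/
open MeasureTheory Set Filter

lemma repr_of_linear (nu : Measure ℝ) [IsFiniteMeasure nu] (Φ : (ℝ → ℝ) →ₗ[ℝ] ℝ)
    (hΦ : ∀ u, Integrable u nu → Φ u ≤ ∫ x, max (u x) 0 ∂nu) :
    ∃ eta : Measure ℝ, eta ≤ nu ∧ ∀ u, Integrable u nu → ∫ x, u x ∂eta = Φ u := by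
  have hpos : ∀ u, Integrable u nu → (∀ x, 0 ≤ u x) → 0 ≤ Φ u := by
    intro u hu h0
    have h := hΦ (-u) hu.neg
    have : (fun x => max ((-u) x) 0) = fun _ => (0 : ℝ) := by
      funext x; simp [h0 x]
    rw [this] at h
    simp at h; exact h
  have hle : ∀ u, Integrable u nu → (∀ x, 0 ≤ u x) → Φ u ≤ ∫ x, u x ∂nu := by
    intro u hu h0
    have h := hΦ u hu
    have : (fun x => max (u x) 0) = u := by
      funext x; simp [h0 x]
    rwa [this] at h
  have habs : ∀ u, Integrable u nu → |Φ u| ≤ ∫ x, |u x| ∂nu := by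
    intro u hu
    rw [abs_le]
    constructor
    · have h := hΦ (-u) hu.neg
      have h2 : ∫ x, max ((-u) x) 0 ∂nu ≤ ∫ x, |u x| ∂nu :=
        integral_mono hu.neg.pos_part hu.abs
          (fun x => max_le (by simpa using neg_le_abs (u x)) (abs_nonneg _))
      rw [map_neg] at h; linarith
    · have h := hΦ u hu
      exact h.trans (integral_mono hu.pos_part hu.abs
          (fun x => max_le (le_abs_self (u x)) (abs_nonneg _)))
  let I : Set ℝ → ℝ → ℝ := fun s => s.indicator (fun _ => (1 : ℝ))
  have hI : ∀ s, MeasurableSet s → Integrable (I s) nu := fun s hs =>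
    (integrable_const (1 : ℝ)).indicator hs
  have hI0 : ∀ s x, 0 ≤ I s x := fun s x => indicator_nonneg (fun _ _ => zero_le_one) x
  have hIint : ∀ s, MeasurableSet s → ∫ x, I s x ∂nu = nu.real s := by
    intro s hs
    simp only [I]
    rw [integral_indicator_const _ hs]; simp
  have hU : ∀ (f : ℕ → Set ℝ), (∀ i, MeasurableSet (f i)) → Pairwise (Function.onFun Disjoint f) →
      HasSum (fun i => Φ (I (f i))) (Φ (I (⋃ i, f i))) := by
    intro f hf hd
    have hUm := MeasurableSet.iUnion hf
    rw [hasSum_iff_tendsto_nat_of_nonneg (fun i => hpos _ (hI _ (hf i)) (hI0 _))]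
    have hs : HasSum (fun i => nu.real (f i)) (nu.real (⋃ i, f i)) := by
      have h1 := measure_iUnion hd hf (μ := nu)
      have h2 : (∑' i, nu (f i)) ≠ ⊤ := by rw [← h1]; exact measure_ne_top _ _
      have h3 := ENNReal.hasSum_toReal h2
      have h4 : nu.real (⋃ i, f i) = ∑' i, (nu (f i)).toReal := by
        rw [← ENNReal.tsum_toReal_eq (fun a => measure_ne_top _ _), ← h1]; rfl
      rw [h4]; exact h3
    have hs' := hs.tendsto_sum_nat
    have hv0 : ∀ n x, 0 ≤ (I (⋃ i, f i) - ∑ i ∈ Finset.range n, I (f i)) x := by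
      intro n x
      have h1 : (∑ i ∈ Finset.range n, I (f i)) = I (⋃ i ∈ Finset.range n, f i) := by
        rw [eq_comm]
        have := Finset.indicator_biUnion (Finset.range n) f (f := fun _ : ℝ => (1:ℝ))
          (fun i _ j _ hij => hd hij)
        funext y
        have h2 := congrFun this y
        simpa [I] using h2
      rw [h1, Pi.sub_apply, sub_nonneg]
      apply indicator_le_indicator_of_subset
      · exact iUnion₂_subset (fun i _ => subset_iUnion f i)
      · intro; exact zero_le_one
    have hvi : ∀ n, Integrable (I (⋃ i, f i) - ∑ i ∈ Finset.range n, I (f i)) nu := fun n =>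
      (hI _ hUm).sub (integrable_finsetSum' _ (fun i _ => hI _ (hf i)))
    have e1 : ∀ n, Φ (I (⋃ i, f i) - ∑ i ∈ Finset.range n, I (f i)) =
        Φ (I (⋃ i, f i)) - ∑ i ∈ Finset.range n, Φ (I (f i)) := by
      intro n; rw [map_sub, map_sum]
    have e2 : ∀ n, ∫ x, (I (⋃ i, f i) - ∑ i ∈ Finset.range n, I (f i)) x ∂nu =
        nu.real (⋃ i, f i) - ∑ i ∈ Finset.range n, nu.real (f i) := by
      intro n
      rw [integral_sub' (hI _ hUm) (integrable_finsetSum' _ (fun i _ => hI _ (hf i))), hIint _ hUm]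
      congr 1
      simp only [Finset.sum_apply]
      rw [integral_finsetSum _ (fun i _ => hI _ (hf i))]
      exact Finset.sum_congr rfl (fun i _ => hIint _ (hf i))
    have hz : Tendsto (fun n => Φ (I (⋃ i, f i)) - ∑ i ∈ Finset.range n, Φ (I (f i))) atTop
        (nhds 0) := by
      refine tendsto_of_tendsto_of_tendsto_of_le_of_le tendsto_const_nhds
        (h := fun n => nu.real (⋃ i, f i) - ∑ i ∈ Finset.range n, nu.real (f i)) ?_ ?_ ?_
      · simpa using (tendsto_const_nhds (x := nu.real (⋃ i, f i))).sub hs'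
      · intro n; simp only; rw [← e1]; exact hpos _ (hvi n) (hv0 n)
      · intro n; simp only; rw [← e1, ← e2]; exact hle _ (hvi n) (hv0 n)
    simpa using (tendsto_const_nhds (x := Φ (I (⋃ i, f i)))).sub hz
  let eta : Measure ℝ := Measure.ofMeasurable (fun s _ => ENNReal.ofReal (Φ (I s)))
    (by simp [I]; rw [show (fun _ : ℝ => (0:ℝ)) = 0 from rfl, map_zero])
    (by
      intro f hf hd
      have h := hU f hf hd
      rw [← h.tsum_eq, ENNReal.ofReal_tsum_of_nonneg (fun i => hpos _ (hI _ (hf i)) (hI0 _))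
        h.summable])
  have heta : ∀ s, MeasurableSet s → eta s = ENNReal.ofReal (Φ (I s)) := fun s hs =>
    Measure.ofMeasurable_apply s hs
  have hetale : eta ≤ nu := by
    rw [Measure.le_iff]
    intro s hs
    rw [heta s hs, ← ofReal_measureReal (μ := nu) (s := s), ← hIint s hs]
    exact ENNReal.ofReal_le_ofReal (hle _ (hI s hs) (hI0 s))
  have : IsFiniteMeasure eta := isFiniteMeasure_of_le nu hetale
  refine ⟨eta, hetale, ?_⟩
  have hcongr : ∀ f g : ℝ → ℝ, f =ᵐ[nu] g → Integrable f nu → Φ f = Φ g := by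
    intro f g hfg hf
    have hg := hf.congr hfg
    have h := habs (f - g) (hf.sub hg)
    have h0 : ∫ x, |(f - g) x| ∂nu = 0 := by
      rw [← integral_zero ℝ ℝ (μ := nu)]
      apply integral_congr_ae
      filter_upwards [hfg] with x hx
      simp [hx]
    rw [h0, map_sub] at h
    have := abs_nonpos_iff.1 h
    linarith
  intro u hu
  refine Integrable.induction (P := fun u => ∫ x, u x ∂eta = Φ u) ?_ ?_ ?_ ?_ hu
  · intro c s hs _
    have : (s.indicator fun _ => c) = c • I s := by
      funext x; simp only [I, Pi.smul_apply, indicator, smul_eq_mul]; split_ifs <;> simp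
    rw [integral_indicator_const _ hs, this, map_smul, smul_eq_mul, smul_eq_mul, mul_comm,
      Measure.real, heta s hs, ENNReal.toReal_ofReal (hpos _ (hI s hs) (hI0 s))]
  · intro f g _ hf hg h1 h2
    rw [map_add, ← h1, ← h2]
    exact integral_add (hf.mono_measure hetale) (hg.mono_measure hetale)
  · apply isClosed_eq
    · refine LipschitzWith.continuous (K := 1) (LipschitzWith.of_dist_le_mul ?_)
      intro f g
      have hf := L1.integrable_coeFn f
      have hg := L1.integrable_coeFn g
      have hf' := hf.mono_measure hetale
      have hg' := hg.mono_measure hetale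
      rw [Real.dist_eq, ← integral_sub hf' hg', L1.dist_eq_integral_dist, NNReal.coe_one, one_mul]
      refine (abs_integral_le_integral_abs).trans ?_
      exact integral_mono_measure hetale (Eventually.of_forall fun x => abs_nonneg _)
        (hf.sub hg).abs
    · refine LipschitzWith.continuous (K := 1) (LipschitzWith.of_dist_le_mul ?_)
      intro f g
      have hf := L1.integrable_coeFn f
      have hg := L1.integrable_coeFn g
      rw [Real.dist_eq, ← map_sub, L1.dist_eq_integral_dist, NNReal.coe_one, one_mul]
      exact habs _ (hf.sub hg)
  · intro f g hfg hf h
    rw [← hcongr f g hfg hf, ← h]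
    exact (integral_congr_ae (Measure.absolutelyContinuous_of_le hetale hfg)).symm

/-- Convex functions of at most linear growth. -/
def LinCvx (f : ℝ → ℝ) : Prop :=
  ConvexOn ℝ Set.univ f ∧ ∃ C : ℝ, ∀ x, |f x| ≤ C * (1 + |x|)

/-- Convex order tested on convex functions of linear growth. -/
def LCx (a b : Measure ℝ) : Prop := ∀ f, LinCvx f → ∫ x, f x ∂a ≤ ∫ x, f x ∂b

lemma LinCvx.integrable {f : ℝ → ℝ} (hf : LinCvx f) (mu : Measure ℝ) [IsFiniteMeasure mu]
    (h : Integrable (fun x => x) mu) : Integrable f mu := by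
  obtain ⟨hc, C, hC⟩ := hf
  have hcont : Continuous f := hc.locallyLipschitz.continuous
  refine Integrable.mono' (((integrable_const (1:ℝ)).add h.abs).const_mul C)
    hcont.aestronglyMeasurable (Eventually.of_forall fun x => ?_)
  simpa using hC x

lemma LinCvx.affine (c d : ℝ) : LinCvx (fun x => c * x + d) := by
  refine ⟨⟨convex_univ, fun x _ y _ a b _ _ hab => ?_⟩, |c| + |d|, fun x => ?_⟩
  · simp only [smul_eq_mul]
    have : d = (a + b) * d := by rw [hab, one_mul]
    nlinarith
  · have h1 := abs_add_le (c * x) d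
    rw [abs_mul] at h1
    nlinarith [abs_nonneg c, abs_nonneg d, abs_nonneg x, mul_nonneg (abs_nonneg d) (abs_nonneg x)]

lemma LinCvx.sup {f g : ℝ → ℝ} (hf : LinCvx f) (hg : LinCvx g) :
    LinCvx (fun x => max (f x) (g x)) := by
  obtain ⟨hc, C, hC⟩ := hf
  obtain ⟨hd, D, hD⟩ := hg
  refine ⟨hc.sup hd, max C D, fun x => ?_⟩
  have h0 : 0 ≤ 1 + |x| := by positivity
  have h1 := mul_le_mul_of_nonneg_right (le_max_left C D) h0
  have h2 := mul_le_mul_of_nonneg_right (le_max_right C D) h0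
  refine (abs_max_le_max_abs_abs).trans (max_le ((hC x).trans h1) ((hD x).trans h2))

lemma LinCvx.add {f g : ℝ → ℝ} (hf : LinCvx f) (hg : LinCvx g) : LinCvx (f + g) := by
  obtain ⟨hc, C, hC⟩ := hf
  obtain ⟨hd, D, hD⟩ := hg
  refine ⟨hc.add hd, C + D, fun x => ?_⟩
  have := abs_add_le (f x) (g x)
  simp only [Pi.add_apply]
  linarith [hC x, hD x]

lemma LinCvx.smul {f : ℝ → ℝ} (hf : LinCvx f) {c : ℝ} (h : 0 ≤ c) : LinCvx (c • f) := by
  obtain ⟨hc, C, hC⟩ := hf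
  refine ⟨hc.smul h, c * C, fun x => ?_⟩
  simp only [Pi.smul_apply, smul_eq_mul, abs_mul, abs_of_nonneg h]
  have := mul_le_mul_of_nonneg_left (hC x) h
  linarith

lemma LinCvx.zero : LinCvx 0 := by
  have h := LinCvx.affine 0 0
  have e : (fun x : ℝ => (0 : ℝ) * x + 0) = 0 := by funext x; simp
  rwa [e] at h

lemma Cx.lcx {a b : Measure ℝ} [IsFiniteMeasure a] [IsFiniteMeasure b]
    (ha : Integrable (fun x => x) a) (hb : Integrable (fun x => x) b) (h : Cx a b) : LCx a b :=
  fun f hf => h f hf.1 (hf.integrable a ha) (hf.integrable b hb)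

lemma LCx.cx {a b : Measure ℝ} [IsFiniteMeasure a] [IsFiniteMeasure b]
    (ha : Integrable (fun x => x) a) (hb : Integrable (fun x => x) b) (h : LCx a b) : Cx a b := by
  intro f hf hfa hfb
  have hcont : Continuous f := hf.locallyLipschitz.continuous
  obtain ⟨l, c, hle, hsup⟩ := hf.real_univ_sSup_of_nat_affine_eq hcont.lowerSemicontinuous
  let A : ℕ → ℝ → ℝ := fun i x => l i x + c i
  have hA : ∀ i, LinCvx (A i) := by
    intro i
    have : A i = fun x => l i 1 * x + c i := by
      funext x
      have : l i x = x * l i 1 := by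
        rw [← smul_eq_mul, ← map_smul, smul_eq_mul, mul_one]
      simp only [A, this]; ring
    rw [this]; exact LinCvx.affine _ _
  have hAle : ∀ i x, A i x ≤ f x := fun i x => hle i x
  let g : ℕ → ℝ → ℝ := fun n => partialSups A n
  have hg : ∀ n, LinCvx (g n) := by
    intro n
    induction n with
    | zero => simpa [g] using hA 0
    | succ n ih =>
      have : g (n + 1) = fun x => max (g n x) (A (n + 1) x) := by
        funext x; simp [g, partialSups_add_one]
      rw [this]; exact ih.sup (hA _)
  have hgle : ∀ n x, g n x ≤ f x := fun n => (partialSups_le A n f (fun i _ x => hAle i x))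
  have hgmono : Monotone g := (partialSups A).monotone
  have hg0 : ∀ n x, A 0 x ≤ g n x := fun n x => (le_partialSups_of_le A (Nat.zero_le n)) x
  have hlim : ∀ x, Tendsto (fun n => g n x) atTop (nhds (f x)) := by
    intro x
    apply tendsto_atTop_isLUB (fun m n hmn => hgmono hmn x)
    constructor
    · rintro _ ⟨n, rfl⟩; exact hgle n x
    · intro y hy
      have h1 : f x = ⨆ i, A i x := by
        conv_lhs => rw [← hsup]
        rw [iSup_apply]; rfl
      rw [h1]
      exact ciSup_le fun i => ((le_partialSups A i) x).trans (hy ⟨i, rfl⟩)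
  have key : ∀ m : Measure ℝ, IsFiniteMeasure m → Integrable (fun x => x) m → Integrable f m →
      Tendsto (fun n => ∫ x, g n x ∂m) atTop (nhds (∫ x, f x ∂m)) := by
    intro m _ hm hfm
    refine tendsto_integral_of_dominated_convergence (fun x => |f x| + |A 0 x|)
      (fun n => ((hg n).integrable m hm).aestronglyMeasurable)
      (hfm.abs.add ((hA 0).integrable m hm).abs) ?_ (Eventually.of_forall hlim)
    intro n
    refine Eventually.of_forall fun x => ?_
    rw [Real.norm_eq_abs, abs_le]
    constructor
    · linarith [hg0 n x, neg_abs_le (A 0 x), abs_nonneg (f x)]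
    · linarith [hgle n x, le_abs_self (f x), abs_nonneg (A 0 x)]
  exact le_of_tendsto_of_tendsto' (key a ‹_› ha hfa) (key b ‹_› hb hfb) (fun n => h _ (hg n))

lemma LCx.antisymm {a b : Measure ℝ} [IsFiniteMeasure a] [IsFiniteMeasure b]
    (ha : Integrable (fun x => x) a) (hb : Integrable (fun x => x) b)
    (h1 : LCx a b) (h2 : LCx b a) : a = b := by
  have heq : ∀ f, LinCvx f → ∫ x, f x ∂a = ∫ x, f x ∂b := fun f hf => le_antisymm (h1 f hf) (h2 f hf)
  apply Measure.ext_of_Iic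
  intro k
  let p : ℝ → ℝ → ℝ := fun k x => max (k - x) 0
  have hp : ∀ k, LinCvx (p k) := by
    intro k
    have := (LinCvx.affine (-1) k).sup LinCvx.zero
    have e : p k = fun x => max (-1 * x + k) ((0 : ℝ → ℝ) x) := by
      funext x; simp only [p, Pi.zero_apply]; congr 1; ring
    rw [e]; exact this
  let w : ℕ → ℝ → ℝ := fun n x => ((n : ℝ) + 1) * (p (k + 1 / ((n : ℝ) + 1)) x - p k x)
  have hweq : ∀ n, ∫ x, w n x ∂a = ∫ x, w n x ∂b := by
    intro n
    simp only [w]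
    rw [integral_const_mul, integral_const_mul,
      integral_sub ((hp _).integrable a ha) ((hp _).integrable a ha),
      integral_sub ((hp _).integrable b hb) ((hp _).integrable b hb), heq _ (hp _), heq _ (hp _)]
  have hw01 : ∀ n x, 0 ≤ w n x ∧ w n x ≤ 1 := by
    intro n x
    have hn : (0 : ℝ) < (n : ℝ) + 1 := by positivity
    have hd : 0 < 1 / ((n : ℝ) + 1) := by positivity
    have hdn : ((n : ℝ) + 1) * (1 / ((n : ℝ) + 1)) = 1 := by field_simp
    have h1 : 0 ≤ p (k + 1 / ((n : ℝ) + 1)) x - p k x := by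
      simp only [p]
      have : max (k - x) 0 ≤ max (k + 1 / ((n : ℝ) + 1) - x) 0 :=
        max_le_max (by linarith) le_rfl
      linarith
    have h2 : p (k + 1 / ((n : ℝ) + 1)) x - p k x ≤ 1 / ((n : ℝ) + 1) := by
      simp only [p]
      have : max (k + 1 / ((n : ℝ) + 1) - x) 0 ≤ max (k - x) 0 + 1 / ((n : ℝ) + 1) :=
        max_le (by linarith [le_max_left (k - x) 0]) (by linarith [le_max_right (k - x) 0])
      linarith
    exact ⟨mul_nonneg hn.le h1, (mul_le_mul_of_nonneg_left h2 hn.le).trans hdn.le⟩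
  have hlim : ∀ x, Tendsto (fun n => w n x) atTop (nhds ((Iic k).indicator (fun _ => (1:ℝ)) x)) := by
    intro x
    by_cases hx : x ≤ k
    · rw [indicator_of_mem (show x ∈ Iic k from hx)]
      refine tendsto_const_nhds.congr fun n => ?_
      have hd : 0 < 1 / ((n : ℝ) + 1) := by positivity
      simp only [w, p]
      rw [max_eq_left (by linarith), max_eq_left (by linarith)]
      field_simp; ring
    · rw [indicator_of_notMem (show x ∉ Iic k from hx)]
      push Not at hx
      refine tendsto_const_nhds.congr' ?_
      have := (tendsto_one_div_add_atTop_nhds_zero_nat (𝕜 := ℝ)).eventually_lt_const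
        (sub_pos.2 hx)
      filter_upwards [this] with n hn
      simp only [w, p]
      rw [max_eq_right (by linarith), max_eq_right (by linarith)]
      simp
  have key : ∀ m : Measure ℝ, IsFiniteMeasure m → Integrable (fun x => x) m →
      Tendsto (fun n => ∫ x, w n x ∂m) atTop (nhds (m.real (Iic k))) := by
    intro m _ hm
    have e : m.real (Iic k) = ∫ x, (Iic k).indicator (fun _ => (1:ℝ)) x ∂m := by
      rw [integral_indicator_const _ measurableSet_Iic]; simp
    rw [e]
    refine tendsto_integral_of_dominated_convergence (fun _ => 1)
      (fun n => ((((hp _).integrable m hm).sub ((hp _).integrable m hm)).const_mul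
        _).aestronglyMeasurable)
      (integrable_const _) ?_ (Eventually.of_forall hlim)
    intro n
    refine Eventually.of_forall fun x => ?_
    rw [Real.norm_eq_abs, abs_of_nonneg (hw01 n x).1]
    exact (hw01 n x).2
  have h := tendsto_nhds_unique (key a ‹_› ha) ((key b ‹_› hb).congr fun n => (hweq n).symm)
  rw [← ofReal_measureReal (μ := a), ← ofReal_measureReal (μ := b), h]

/-- Splitting lemma. -/
lemma split_cx {a b nu : Measure ℝ} [IsFiniteMeasure a] [IsFiniteMeasure b] [IsFiniteMeasure nu]
    (ha : Integrable (fun x => x) a) (hb : Integrable (fun x => x) b)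
    (hn : Integrable (fun x => x) nu)
    (h : ∀ f, LinCvx f → ∫ x, f x ∂a + ∫ x, f x ∂b ≤ ∫ x, f x ∂nu) :
    ∃ eta ≤ nu, LCx a eta ∧ ∀ f, LinCvx f → ∫ x, f x ∂eta + ∫ x, f x ∂b ≤ ∫ x, f x ∂nu := by
  let E : Submodule ℝ (ℝ → ℝ) :=
    { carrier := {u | Integrable u nu}
      zero_mem' := integrable_zero _ _ _
      add_mem' := fun hf hg => Integrable.add hf hg
      smul_mem' := fun c f hf => Integrable.smul c hf }
  have hE : ∀ u : E, Integrable (u : ℝ → ℝ) nu := fun u => u.2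
  let Q : E × ℝ → (ℝ → ℝ) → (ℝ → ℝ) → Prop := fun q f g =>
    ∫ x, max (q.1.1 x + f x - g x) 0 ∂nu - ∫ x, f x ∂a + ∫ x, g x ∂nu - ∫ x, g x ∂b ≤ q.2
  have hi : ∀ (u : E) f g, LinCvx f → LinCvx g →
      Integrable (fun x => max (u.1 x + f x - g x) 0) nu := fun u f g hf hg =>
    (((hE u).add (hf.integrable nu hn)).sub (hg.integrable nu hn)).pos_part
  let s : PointedCone ℝ (E × ℝ) :=
    { carrier := {q | ∃ f g, LinCvx f ∧ LinCvx g ∧ Q q f g}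
      zero_mem' := ⟨0, 0, LinCvx.zero, LinCvx.zero, by simp [Q]⟩
      smul_mem' := by
        rintro ⟨c, hc⟩ ⟨u, t⟩ ⟨f, g, hf, hg, hQ⟩
        refine ⟨c • f, c • g, hf.smul hc, hg.smul hc, ?_⟩
        have e : ∀ x, max (c * u.1 x + c * f x - c * g x) 0 = c * max (u.1 x + f x - g x) 0 := by
          intro x
          rw [mul_max_of_nonneg _ _ hc]; congr 1 <;> ring
        have hQ' := mul_le_mul_of_nonneg_left hQ hc
        simp only [Q] at hQ' ⊢
        change ∫ x, max (c * u.1 x + c * f x - c * g x) 0 ∂nu - ∫ x, c * f x ∂a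
          + ∫ x, c * g x ∂nu - ∫ x, c * g x ∂b ≤ c * t
        simp only [e, integral_const_mul]
        linarith
      add_mem' := by
        rintro ⟨u, t⟩ ⟨u', t'⟩ ⟨f, g, hf, hg, hQ⟩ ⟨f', g', hf', hg', hQ'⟩
        refine ⟨f + f', g + g', hf.add hf', hg.add hg', ?_⟩
        simp only [Q] at hQ hQ' ⊢
        rw [integral_add' (hf.integrable a ha) (hf'.integrable a ha),
          integral_add' (hg.integrable nu hn) (hg'.integrable nu hn),
          integral_add' (hg.integrable b hb) (hg'.integrable b hb)]
        have : ∫ x, max ((u + u').1 x + (f + f') x - (g + g') x) 0 ∂nu ≤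
            ∫ x, max (u.1 x + f x - g x) 0 ∂nu + ∫ x, max (u'.1 x + f' x - g' x) 0 ∂nu := by
          rw [← integral_add (hi u f g hf hg) (hi u' f' g' hf' hg')]
          refine integral_mono (hi _ _ _ (hf.add hf') (hg.add hg'))
            ((hi u f g hf hg).add (hi u' f' g' hf' hg')) fun x => ?_
          change max ((u.1 x + u'.1 x) + (f x + f' x) - (g x + g' x)) 0 ≤
            max (u.1 x + f x - g x) 0 + max (u'.1 x + f' x - g' x) 0
          refine max_le ?_ (add_nonneg (le_max_right _ _) (le_max_right _ _))
          linarith [le_max_left (u.1 x + f x - g x) 0, le_max_left (u'.1 x + f' x - g' x) 0]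
        change ∫ x, max ((u + u').1 x + (f + f') x - (g + g') x) 0 ∂nu - _ + _ - _ ≤ t + t'
        linarith }
  have hs : ∀ q : E × ℝ, q ∈ s ↔ ∃ f g, LinCvx f ∧ LinCvx g ∧ Q q f g := fun q => Iff.rfl
  let F : (E × ℝ) →ₗ.[ℝ] ℝ :=
    ⟨Submodule.prod ⊥ ⊤, (LinearMap.snd ℝ E ℝ).comp (Submodule.subtype _)⟩
  obtain ⟨G, hG1, hG2⟩ := riesz_extension s F (by
    rintro ⟨⟨u, t⟩, hx⟩ hxs
    obtain ⟨f, g, hf, hg, hQ⟩ := (hs _).1 hxs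
    have hu : u = 0 := by
      have := hx.1
      simpa using this
    subst hu
    change 0 ≤ t
    refine le_trans ?_ hQ
    change 0 ≤ ∫ x, max (0 + f x - g x) 0 ∂nu - ∫ x, f x ∂a + ∫ x, g x ∂nu - ∫ x, g x ∂b
    have hm := hf.sup hg
    have h1 : ∫ x, max (0 + f x - g x) 0 ∂nu + ∫ x, g x ∂nu = ∫ x, max (f x) (g x) ∂nu := by
      have hi0 : Integrable (fun x => max (0 + f x - g x) 0) nu := hi 0 f g hf hg
      rw [← integral_add hi0 (hg.integrable nu hn)]
      congr 1; funext x
      rw [max_add]; congr 1 <;> ring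
    have h2 := h _ hm
    have h3 : ∫ x, f x ∂a ≤ ∫ x, max (f x) (g x) ∂a :=
      integral_mono (hf.integrable a ha) (hm.integrable a ha) fun x => le_max_left _ _
    have h4 : ∫ x, g x ∂b ≤ ∫ x, max (f x) (g x) ∂b :=
      integral_mono (hg.integrable b hb) (hm.integrable b hb) fun x => le_max_right _ _
    linarith) (by
    rintro ⟨u, t⟩
    refine ⟨⟨(0, ∫ x, max (u.1 x) 0 ∂nu - t), ⟨by simp, trivial⟩⟩, (hs _).2 ⟨0, 0, LinCvx.zero,
      LinCvx.zero, ?_⟩⟩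
    simp [Q])
  have hG1' : ∀ t : ℝ, G (0, t) = t := fun t => hG1 ⟨(0, t), ⟨by simp, trivial⟩⟩
  obtain ⟨Φ, hΦ⟩ := LinearMap.exists_extend (-(G.comp (LinearMap.inl ℝ E ℝ)))
  have hΦ' : ∀ u : E, Φ u = - G (u, 0) := fun u => by
    have := LinearMap.congr_fun hΦ u
    simpa using this
  have hb' : ∀ (u : ℝ → ℝ) (hu : Integrable u nu) f g, LinCvx f → LinCvx g →
      Φ u ≤ ∫ x, max (u x + f x - g x) 0 ∂nu - ∫ x, f x ∂a + ∫ x, g x ∂nu - ∫ x, g x ∂b := by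
    intro u hu f g hf hg
    let U : E := ⟨u, hu⟩
    have h1 := hG2 (U, ∫ x, max (u x + f x - g x) 0 ∂nu - ∫ x, f x ∂a + ∫ x, g x ∂nu
      - ∫ x, g x ∂b) ((hs _).2 ⟨f, g, hf, hg, le_refl _⟩)
    have h2 : ∀ t : ℝ, G (U, t) = G (U, 0) + t := by
      intro t
      conv_rhs => rw [← hG1' t, ← map_add]
      simp
    rw [h2] at h1
    have h3 : Φ u = - G (U, 0) := hΦ' U
    linarith
  obtain ⟨eta, hle, heta⟩ := repr_of_linear nu Φ (fun u hu => by
    simpa using hb' u hu 0 0 LinCvx.zero LinCvx.zero)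
  refine ⟨eta, hle, fun f hf => ?_, fun f hf => ?_⟩
  · have h1 := hb' (-f) (hf.integrable nu hn).neg f 0 hf LinCvx.zero
    rw [map_neg, ← heta f (hf.integrable nu hn)] at h1
    simp at h1
    exact h1
  · have h1 := hb' f (hf.integrable nu hn) 0 f LinCvx.zero hf
    rw [← heta f (hf.integrable nu hn)] at h1
    simp at h1
    linarith

lemma shadow_key {a b nu S : Measure ℝ} [IsFiniteMeasure a] [IsFiniteMeasure b]
    [IsFiniteMeasure nu]
    (ha : Integrable (fun x => x) a) (hb : Integrable (fun x => x) b)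
    (hn : Integrable (fun x => x) nu) (hS : IsShadow a nu S)
    (h : ∀ f, LinCvx f → ∫ x, f x ∂a + ∫ x, f x ∂b ≤ ∫ x, f x ∂nu) :
    ∀ f, LinCvx f → ∫ x, f x ∂S + ∫ x, f x ∂b ≤ ∫ x, f x ∂nu := by
  obtain ⟨eta, hle, h1, h2⟩ := split_cx ha hb hn h
  have : IsFiniteMeasure eta := isFiniteMeasure_of_le nu hle
  have : IsFiniteMeasure S := isFiniteMeasure_of_le nu hS.2.1
  have he := hn.mono_measure hle
  have h3 := (hS.2.2 eta (h1.cx ha he) hle).lcx (hn.mono_measure hS.2.1) he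
  intro f hf
  linarith [h3 f hf, h2 f hf]

theorem stmt17 (mu1 mu2 nu : Measure ℝ)
    [IsFiniteMeasure mu1] [IsFiniteMeasure mu2] [IsFiniteMeasure nu]
    (hint1 : Integrable (fun x => x) mu1) (hint2 : Integrable (fun x => x) mu2)
    (hintn : Integrable (fun x => x) nu)
    (hE : ECx (mu1 + mu2) nu)
    (S1 S2 S : Measure ℝ)
    (hS1 : IsShadow mu1 nu S1)
    (hS2 : IsShadow mu2 (nu - S1) S2)
    (hS : IsShadow (mu1 + mu2) nu S) :
    S = S1 + S2 := by
  have hS1n : S1 ≤ nu := hS1.2.1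
  have hSn : S ≤ nu := hS.2.1
  have f1 : IsFiniteMeasure S1 := isFiniteMeasure_of_le nu hS1n
  have f2 : IsFiniteMeasure S := isFiniteMeasure_of_le nu hSn
  have e1 : nu - S1 + S1 = nu := Measure.sub_add_cancel_of_le hS1n
  have e2 : nu - S + S = nu := Measure.sub_add_cancel_of_le hSn
  have l1 : nu - S1 ≤ nu := Measure.sub_le
  have l2 : nu - S ≤ nu := Measure.sub_le
  have l3 : S2 ≤ nu := hS2.2.1.trans l1
  have f3 : IsFiniteMeasure S2 := isFiniteMeasure_of_le nu l3
  have f4 : IsFiniteMeasure (nu - S1) := isFiniteMeasure_of_le nu l1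
  have f5 : IsFiniteMeasure (nu - S) := isFiniteMeasure_of_le nu l2
  have i1 := hintn.mono_measure hS1n
  have i2 := hintn.mono_measure hSn
  have i3 := hintn.mono_measure l3
  have i4 := hintn.mono_measure l1
  have i5 := hintn.mono_measure l2
  have a1 : ∀ f, LinCvx f → ∫ x, f x ∂nu = ∫ x, f x ∂(nu - S1) + ∫ x, f x ∂S1 := by
    intro f hf
    rw [← integral_add_measure (hf.integrable _ i4) (hf.integrable _ i1), e1]
  have a2 : ∀ f, LinCvx f → ∫ x, f x ∂nu = ∫ x, f x ∂(nu - S) + ∫ x, f x ∂S := by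
    intro f hf
    rw [← integral_add_measure (hf.integrable _ i5) (hf.integrable _ i2), e2]
  have i12 : Integrable (fun x => x) (S1 + S2) := i1.add_measure i3
  have im : Integrable (fun x => x) (mu1 + mu2) := hint1.add_measure hint2
  have a12 : ∀ f, LinCvx f → ∫ x, f x ∂(S1 + S2) = ∫ x, f x ∂S1 + ∫ x, f x ∂S2 := fun f hf =>
    integral_add_measure (hf.integrable _ i1) (hf.integrable _ i3)
  have am : ∀ f, LinCvx f → ∫ x, f x ∂(mu1 + mu2) = ∫ x, f x ∂mu1 + ∫ x, f x ∂mu2 := fun f hf =>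
    integral_add_measure (hf.integrable _ hint1) (hf.integrable _ hint2)
  refine LCx.antisymm i2 i12 ?_ ?_
  · -- minimality of `S`
    have c1 := hS1.1.lcx hint1 i1
    have c2 := hS2.1.lcx hint2 i3
    have c : LCx (mu1 + mu2) (S1 + S2) := fun f hf => by
      rw [am f hf, a12 f hf]; exact add_le_add (c1 f hf) (c2 f hf)
    have hle : S1 + S2 ≤ nu := by
      rw [← e1, add_comm S1 S2]
      exact add_le_add hS2.2.1 le_rfl
    exact (hS.2.2 _ (c.cx im i12) hle).lcx i2 i12
  · have c := hS.1.lcx im i2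
    have ib : Integrable (fun x => x) (mu2 + (nu - S)) := hint2.add_measure i5
    have ab : ∀ f, LinCvx f → ∫ x, f x ∂(mu2 + (nu - S)) = ∫ x, f x ∂mu2 + ∫ x, f x ∂(nu - S) :=
      fun f hf => integral_add_measure (hf.integrable _ hint2) (hf.integrable _ i5)
    have k1 := shadow_key hint1 ib hintn hS1 (fun f hf => by
      have := c f hf
      rw [am f hf] at this
      rw [ab f hf, a2 f hf]; linarith)
    have k2 := shadow_key hint2 i5 i4 hS2 (fun f hf => by
      have := k1 f hf
      rw [ab f hf, a1 f hf] at this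
      linarith)
    intro f hf
    have := k2 f hf
    rw [a12 f hf]
    linarith [a1 f hf, a2 f hf]
end
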